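/- arXiv:2307.03044 — 3 statements merged into one kernel-verified Lean document; each statement's English description precedes it below -/
import Mathlib

section
/- Let G be the dihedral group of order 2m with m ≥ 3 odd, and let V be any faithful 2-dimensional complex representation of G. Then the number b(n) of simple summands (with multiplicity) of V^{⊗n} satisfies b(n) ~ ((m+1)/(2m)) · 2^n, i.e. b(n)·2^{−n} → (m+1)/(2m) as n → ∞. -/
open CategoryTheory MonoidalCategory

/-- The `n`-th tensor power of a finite dimensional representation. -/
noncomputable def tpow {k G : Type} [Field k] [Monoid G] (V : FDRep k G) : ℕ → FDRep k G
  | 0 => 𝟙_ (FDRep k G)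
  | n + 1 => tpow V n ⊗ V

open Module

namespace Representation

variable {k G W : Type} [Field k] [AddCommGroup W] [Module k W]

theorem character_eq_add_of_isCompl [Monoid G] [FiniteDimensional k W] {ρ : Representation k G W}
    {p q : Subrepresentation ρ} (h : IsCompl p.toSubmodule q.toSubmodule) :
    ρ.character = p.toRepresentation.character + q.toRepresentation.character := by
  ext g
  have hint : DirectSum.IsInternal (fun b : Bool => if b then p.toSubmodule else q.toSubmodule) :=
    (DirectSum.isInternal_submodule_iff_isCompl _ (i := true) (j := false) (by simp)
      (by ext b; cases b <;> simp)).2 (by simpa using h)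
  have hmaps : ∀ b : Bool, Set.MapsTo (ρ g)
      (if b then p.toSubmodule else q.toSubmodule : Submodule k W)
      (if b then p.toSubmodule else q.toSubmodule : Submodule k W) := by
    rintro (_ | _)
    exacts [q.apply_mem_toSubmodule g, p.apply_mem_toSubmodule g]
  have := LinearMap.trace_eq_sum_trace_restrict hint hmaps
  rw [Fintype.sum_bool] at this
  exact this

theorem isCompl_toSubmodule [Monoid G] {ρ : Representation k G W} {p q : Subrepresentation ρ}
    (h : IsCompl p q) : IsCompl p.toSubmodule q.toSubmodule := by
  constructor
  · rw [disjoint_iff]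
    exact congrArg Subrepresentation.toSubmodule h.inf_eq_bot
  · rw [codisjoint_iff]
    exact congrArg Subrepresentation.toSubmodule h.sup_eq_top

/-- A property of class functions that is closed under sums and holds for irreducible characters
holds for every character of a finite group in good characteristic. -/
theorem character_induction [Group G] [Finite G] [NeZero (Nat.card G : k)] {P : (G → k) → Prop}
    (zero : P 0) (add : ∀ χ ψ, P χ → P ψ → P (χ + ψ))
    (irreducible : ∀ {W : Type} [AddCommGroup W] [Module k W] [FiniteDimensional k W]
      (ρ : Representation k G W), ρ.IsIrreducible → P ρ.character)
    [FiniteDimensional k W] (ρ : Representation k G W) : P ρ.character := by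
  induction hd : finrank k W using Nat.strong_induction_on generalizing W with
  | _ d ih =>
    subst hd
    by_cases hW : Nontrivial W
    · by_cases hρ : ρ.IsIrreducible
      · exact irreducible ρ hρ
      · have : Nontrivial (Subrepresentation ρ) :=
          ⟨⊥, ⊤, fun h => bot_ne_top (α := Submodule k W)
            (congrArg Subrepresentation.toSubmodule h)⟩
        obtain ⟨p, hbot, htop⟩ : ∃ p : Subrepresentation ρ, p ≠ ⊥ ∧ p ≠ ⊤ := by
          by_contra! hp
          exact hρ ⟨fun p => or_iff_not_imp_left.2 (hp p)⟩
        have hss : ρ.IsSemisimpleRepresentation :=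
          (isSemisimpleRepresentation_iff_isSemisimpleModule_asModule ρ).2 inferInstance
        obtain ⟨q, hpq⟩ := exists_isCompl p
        have hpq' := isCompl_toSubmodule hpq
        rw [character_eq_add_of_isCompl hpq']
        have hsum := Submodule.finrank_add_eq_of_isCompl hpq'
        have hp : p.toSubmodule ≠ ⊥ := fun h => hbot (Subrepresentation.toSubmodule_injective h)
        have hlt := Submodule.finrank_lt (s := p.toSubmodule)
          (fun h => htop (Subrepresentation.toSubmodule_injective h))
        have hpos := Submodule.one_le_finrank_iff.2 hp
        exact add _ _ (ih _ hlt _ rfl) (ih _ (by omega) _ rfl)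
    · have := not_nontrivial_iff_subsingleton.1 hW
      have h0 : ρ.character = 0 := by
        ext g
        rw [character, Subsingleton.elim (ρ g) 0, map_zero, Pi.zero_apply]
      rwa [h0]

end Representation

namespace FDRep

open Representation

/-- The numbers of copies of the simple representations in an irreducible representation
add up to one. -/
theorem sum_finrank_hom_of_isIrreducible {k G ι W : Type} [Field k] [IsAlgClosed k] [Group G]
    [Finite G] [CharZero k] [Fintype ι] {S : ι → FDRep k G} (hsimple : ∀ i, Simple (S i))
    (hdistinct : ∀ i j, Nonempty (S i ≅ S j) → i = j)
    (hall : ∀ W : FDRep k G, Simple W → ∃ i, Nonempty (W ≅ S i))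
    [AddCommGroup W] [Module k W] [FiniteDimensional k W] (ρ : Representation k G W)
    (hρ : ρ.IsIrreducible) : ∑ i, finrank k (S i ⟶ FDRep.of ρ) = 1 := by
  classical
  have := Fintype.ofFinite G
  have := invertibleOfNonzero (NeZero.ne (Nat.card G : k))
  have hend : Simple (FDRep.of ρ) := by
    rw [simple_iff_end_is_rank_one, ← Nat.cast_inj (R := k),
      ← scalar_product_char_eq_finrank_equivariant]
    have h := card_inv_mul_sum_char_mul_char_eq_finrank ρ ρ
    rw [IsIrreducible.finrank_intertwiningMap_self] at h
    exact h
  obtain ⟨j, ⟨e⟩⟩ := hall _ hend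
  have hterm : ∀ i, finrank k (S i ⟶ FDRep.of ρ) = if i = j then 1 else 0 := by
    intro i
    have := hsimple i
    rw [finrank_hom_simple_simple]
    refine if_congr ⟨fun ⟨f⟩ => hdistinct _ _ ⟨f ≪≫ e⟩, ?_⟩ rfl rfl
    rintro rfl
    exact ⟨e.symm⟩
  simp [hterm]

end FDRep

theorem Module.End.HasEigenvector.pow_eq_one {k W : Type*} [Field k] [AddCommGroup W] [Module k W]
    {A : Module.End k W} {c : k} {v : W} (hv : A.HasEigenvector c v) {m : ℕ} (hA : A ^ m = 1) :
    c ^ m = 1 := by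
  have h : c ^ m • v = (1 : k) • v := by rw [← hv.pow_apply, hA, one_smul, Module.End.one_apply]
  exact smul_left_injective k hv.2 h

/-- An endomorphism of finite order of a complex plane has trace of absolute value less than `2`
unless it is a scalar. -/
theorem Module.End.norm_trace_lt_two_or_eq_smul_one {W : Type*} [AddCommGroup W] [Module ℂ W]
    [FiniteDimensional ℂ W] (hW : finrank ℂ W = 2) {A : Module.End ℂ W} {m : ℕ} (hm : m ≠ 0)
    (hA : A ^ m = 1) : ‖LinearMap.trace ℂ W A‖ < 2 ∨ ∃ c : ℂ, A = c • 1 := by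
  have hsplit : A.charpoly.Splits := IsAlgClosed.splits _
  have hcard : A.charpoly.roots.card = 2 := by
    rw [← hsplit.natDegree_eq_card_roots, LinearMap.charpoly_natDegree, hW]
  obtain ⟨a, b, hab⟩ := Multiset.card_eq_two.1 hcard
  have hnorm : ∀ c ∈ A.charpoly.roots, ‖c‖ = 1 := by
    intro c hc
    have hev : A.HasEigenvalue c :=
      (Module.End.hasEigenvalue_iff_isRoot_charpoly A c).2 (Polynomial.isRoot_of_mem_roots hc)
    obtain ⟨v, hv⟩ := hev.exists_hasEigenvector
    exact Complex.norm_eq_one_of_pow_eq_one (hv.pow_eq_one hA) hm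
  have ha : ‖a‖ = 1 := hnorm a (by simp [hab])
  have hb : ‖b‖ = 1 := hnorm b (by simp [hab])
  have htr : LinearMap.trace ℂ W A = a + b := by
    rw [Module.End.trace_eq_sum_roots_charpoly_of_splits hsplit, hab]
    simp
  by_cases hne : a = b
  · right
    subst hne
    refine ⟨a, ?_⟩
    have hchar : A.charpoly = (Polynomial.X - Polynomial.C a) ^ 2 := by
      rw [hsplit.eq_prod_roots_of_monic A.charpoly_monic, hab]
      simp [sq]
    have hdvd : minpoly ℂ A ∣ Polynomial.X ^ m - 1 := minpoly.dvd _ _ (by simp [hA])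
    have hsq : Squarefree (minpoly ℂ A) :=
      ((Polynomial.X_pow_sub_one_separable_iff.2 (by exact_mod_cast hm)).squarefree
        ).squarefree_of_dvd hdvd
    have h2 : minpoly ℂ A ∣ Polynomial.X - Polynomial.C a := by
      rw [← hsq.dvd_pow_iff_dvd two_ne_zero, ← hchar]
      exact A.minpoly_dvd_charpoly
    have h3 := (minpoly.dvd_iff.1 h2)
    simpa [sub_eq_zero, Algebra.algebraMap_eq_smul_one] using h3
  · left
    rw [htr]
    have hray : ¬ SameRay ℝ a b := by
      intro h
      exact hne ((sameRay_iff_of_norm_eq (ha.trans hb.symm)).1 h)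
    calc ‖a + b‖ < ‖a‖ + ‖b‖ := norm_add_lt_of_not_sameRay hray
      _ = 2 := by rw [ha, hb]; norm_num

namespace DihedralGroup

open Representation

variable {m : ℕ} {W : Type} [AddCommGroup W] [Module ℂ W]

/-- A nonzero subspace stable under the two standard generators of the dihedral group is the whole
space of an irreducible representation. -/
theorem eq_top_of_isIrreducible [NeZero m] {ρ : Representation ℂ (DihedralGroup m) W}
    (hρ : ρ.IsIrreducible) {p : Submodule ℂ W} (hp : p ≠ ⊥) (hr : ∀ v ∈ p, ρ (r 1) v ∈ p)
    (hs : ∀ v ∈ p, ρ (sr 0) v ∈ p) : p = ⊤ := by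
  have hrot : ∀ (i : ZMod m), ∀ v ∈ p, ρ (r i) v ∈ p := by
    intro i v hv
    rw [← ZMod.natCast_zmod_val i, ← r_one_pow, map_pow]
    exact Module.End.pow_apply_mem_of_forall_mem _ hr v hv
  let q : Subrepresentation ρ := ⟨p, by
    rintro (i | i) v hv
    · exact hrot i v hv
    · rw [← zero_add i, ← sr_mul_r, map_mul]
      exact hs _ (hrot i v hv)⟩
  rcases hρ.eq_bot_or_eq_top q with h | h
  · exact absurd (congrArg Subrepresentation.toSubmodule h) hp
  · exact congrArg Subrepresentation.toSubmodule h

theorem sr_zero_apply_sr_zero_apply (ρ : Representation ℂ (DihedralGroup m) W) (v : W) :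
    ρ (sr 0) (ρ (sr 0) v) = v := by
  rw [← Module.End.mul_apply, ← map_mul, sr_mul_self, map_one, Module.End.one_apply]

theorem nontrivial_of_isIrreducible {ρ : Representation ℂ (DihedralGroup m) W}
    (hρ : ρ.IsIrreducible) : Nontrivial W := by
  by_contra h
  rw [not_nontrivial_iff_subsingleton] at h
  exact bot_ne_top (α := Subrepresentation ρ)
    (Subrepresentation.toSubmodule_injective (Subsingleton.elim _ _))

theorem finrank_eq_one_of_map_r_one_eq_one [NeZero m]
    {ρ : Representation ℂ (DihedralGroup m) W} (hρ : ρ.IsIrreducible) (h : ρ (r 1) = 1) :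
    finrank ℂ W = 1 := by
  have := nontrivial_of_isIrreducible hρ
  obtain ⟨w, hw⟩ := exists_ne (0 : W)
  obtain ⟨v, hv, c, hc⟩ : ∃ v : W, v ≠ 0 ∧ ∃ c : ℂ, ρ (sr 0) v = c • v := by
    by_cases hsw : w + ρ (sr 0) w = 0
    · exact ⟨w, hw, -1, by rw [neg_one_smul]; exact eq_neg_of_add_eq_zero_right hsw⟩
    · exact ⟨_, hsw, 1, by rw [map_add, sr_zero_apply_sr_zero_apply, one_smul, add_comm]⟩
  have htop : Submodule.span ℂ {v} = ⊤ := by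
    refine eq_top_of_isIrreducible hρ (by simpa using hv) (fun u hu => by simpa [h] using hu) ?_
    intro u hu
    obtain ⟨a, rfl⟩ := Submodule.mem_span_singleton.1 hu
    rw [map_smul, hc]
    exact Submodule.smul_mem _ _ (Submodule.smul_mem _ _ (Submodule.mem_span_singleton_self v))
  rw [← finrank_top ℂ W, ← htop, finrank_span_singleton hv]

theorem finrank_eq_two_of_forall_map_r_one_ne [NeZero m] (hodd : Odd m) [FiniteDimensional ℂ W]
    {ρ : Representation ℂ (DihedralGroup m) W} (hρ : ρ.IsIrreducible)
    (h : ∀ v, ρ (r 1) v = v → v = 0) : finrank ℂ W = 2 := by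
  have := nontrivial_of_isIrreducible hρ
  obtain ⟨c, hc⟩ := Module.End.exists_eigenvalue (ρ (r 1))
  obtain ⟨v, hv⟩ := hc.exists_hasEigenvector
  have hcv : ρ (r 1) v = c • v := hv.apply_eq_smul
  have hc1 : c ≠ 1 := by
    rintro rfl
    exact hv.2 (h v (by rw [hcv, one_smul]))
  have hcm : c ^ m = 1 := hv.pow_eq_one (by rw [← map_pow, r_one_pow_n, map_one])
  have hc0 : c ≠ 0 := by
    rintro rfl
    simp [NeZero.ne m] at hcm
  have hcc : c ≠ c⁻¹ := by
    intro hinv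
    have hsq : c ^ 2 = 1 := by
      rw [sq]
      nth_rewrite 2 [hinv]
      exact mul_inv_cancel₀ hc0
    obtain ⟨l, rfl⟩ := hodd
    rw [pow_succ, pow_mul, hsq, one_pow, one_mul] at hcm
    exact hc1 hcm
  set w := ρ (sr 0) v with hw
  have hsw : ρ (sr 0) w = v := sr_zero_apply_sr_zero_apply ρ v
  have hcw : ρ (r 1) w = c⁻¹ • w := by
    have h1 : ρ (r 1) (ρ (sr 0) (ρ (r 1) v)) = w := by
      rw [← Module.End.mul_apply, ← Module.End.mul_apply, ← map_mul, ← map_mul, mul_assoc,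
        sr_mul_r, r_mul_sr]
      simp [hw]
    rw [hcv, map_smul, map_smul] at h1
    rw [← h1, smul_smul, inv_mul_cancel₀ hc0, one_smul, h1]
  have hw0 : w ≠ 0 := by
    intro h0
    rw [h0, map_zero] at hsw
    exact hv.2 hsw.symm
  have hli : LinearIndependent ℂ ![v, w] := by
    refine Module.End.eigenvectors_linearIndependent' (ρ (r 1)) ![c, c⁻¹] ?_ _ ?_
    · intro i j hij
      fin_cases i <;> fin_cases j <;> simp_all
    · intro i
      fin_cases i
      · exact hv
      · exact ⟨Module.End.mem_eigenspace_iff.2 hcw, hw0⟩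
  have htop : Submodule.span ℂ {v, w} = ⊤ := by
    have hvmem : v ∈ Submodule.span ℂ {v, w} := Submodule.subset_span (by simp)
    have hwmem : w ∈ Submodule.span ℂ {v, w} := Submodule.subset_span (by simp)
    refine eq_top_of_isIrreducible hρ (fun hbot => hv.2 (by simpa [hbot] using hvmem)) ?_ ?_
    · intro u hu
      obtain ⟨a, b, rfl⟩ := Submodule.mem_span_pair.1 hu
      simp only [map_add, map_smul, hcv, hcw]
      exact Submodule.add_mem _ (Submodule.smul_mem _ _ (Submodule.smul_mem _ _ hvmem))
        (Submodule.smul_mem _ _ (Submodule.smul_mem _ _ hwmem))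
    · intro u hu
      obtain ⟨a, b, rfl⟩ := Submodule.mem_span_pair.1 hu
      simp only [map_add, map_smul, hsw, ← hw]
      exact Submodule.add_mem _ (Submodule.smul_mem _ _ hwmem) (Submodule.smul_mem _ _ hvmem)
  have hcard := finrank_span_eq_card hli
  rwa [Matrix.range_cons, Matrix.range_cons, Matrix.range_empty, Set.union_empty,
    Set.singleton_union, htop, finrank_top, Fintype.card_fin] at hcard

theorem sum_character_r_of_isIrreducible [NeZero m] (hodd : Odd m) [FiniteDimensional ℂ W]
    {ρ : Representation ℂ (DihedralGroup m) W} (hρ : ρ.IsIrreducible) :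
    m * ρ.character 1 + ∑ k : ZMod m, ρ.character (r k) = 2 * m := by
  let p : Submodule ℂ W := LinearMap.ker (ρ (r 1) - 1)
  have hmem : ∀ v, v ∈ p ↔ ρ (r 1) v = v := fun v => by simp [p, sub_eq_zero]
  by_cases hp : p = ⊥
  · have hd := finrank_eq_two_of_forall_map_r_one_ne hodd hρ
      fun v hv => by simpa [hp] using (hmem v).2 hv
    have hsum : ∑ k : ZMod m, ρ (r k) = 0 := by
      ext v
      have : (∑ k : ZMod m, ρ (r k)) v ∈ p := by
        rw [hmem, ← Module.End.mul_apply, Finset.mul_sum]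
        simp_rw [← map_mul, r_mul_r]
        congr 1
        exact Fintype.sum_equiv (Equiv.addLeft 1) _ _ fun k => rfl
      simpa [hp] using this
    simp_rw [char_one, hd, character, ← map_sum, hsum]
    simp [mul_comm]
  · have hr : ρ (r 1) = 1 := by
      have htop := eq_top_of_isIrreducible hρ hp (fun v hv => by rwa [(hmem v).1 hv]) (by
        intro v hv
        have h1 : r (1 : ZMod m) * sr 0 = sr 0 * (r 1)⁻¹ := by
          rw [inv_r, r_mul_sr, sr_mul_r, zero_sub, zero_add]
        rw [hmem] at hv ⊢
        rw [← Module.End.mul_apply, ← map_mul, h1, map_mul, Module.End.mul_apply]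
        congr 1
        nth_rewrite 1 [← hv]
        rw [← Module.End.mul_apply, ← map_mul, inv_mul_cancel, map_one, Module.End.one_apply])
      ext v
      exact (hmem v).1 (htop ▸ Submodule.mem_top)
    have hd := finrank_eq_one_of_map_r_one_eq_one hρ hr
    have hk : ∀ k : ZMod m, ρ (r k) = 1 := fun k => by
      rw [← ZMod.natCast_zmod_val k, ← r_one_pow, map_pow, hr, one_pow]
    have hk' : ∀ k : ZMod m, ρ.character (r k) = 1 := fun k => by
      rw [character, hk, LinearMap.trace_one, hd, Nat.cast_one]
    simp only [hk', char_one, hd, Finset.sum_const, Finset.card_univ, ZMod.card, nsmul_eq_mul]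
    push_cast
    ring

/-- The total multiplicity of the simple representations of a dihedral group of order `2m`, `m` odd,
in a representation is determined by the values of its character on rotations. -/
theorem two_mul_sum_finrank_hom [NeZero m] (hodd : Odd m) {ι : Type} [Fintype ι]
    {S : ι → FDRep ℂ (DihedralGroup m)} (hsimple : ∀ i, Simple (S i))
    (hdistinct : ∀ i j, Nonempty (S i ≅ S j) → i = j)
    (hall : ∀ W : FDRep ℂ (DihedralGroup m), Simple W → ∃ i, Nonempty (W ≅ S i))
    (U : FDRep ℂ (DihedralGroup m)) :
    2 * (m : ℂ) * ∑ i, (finrank ℂ (S i ⟶ U) : ℂ) =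
      m * U.character 1 + ∑ k : ZMod m, U.character (r k) := by
  have := invertibleOfNonzero (NeZero.ne (Nat.card (DihedralGroup m) : ℂ))
  simp_rw [← FDRep.scalar_product_char_eq_finrank_equivariant]
  refine character_induction (ρ := U.ρ) (P := fun χ : DihedralGroup m → ℂ =>
    2 * m * ∑ i, (Nat.card (DihedralGroup m) : ℂ)⁻¹ * ∑ g, χ g * (S i).character g⁻¹ =
      m * χ 1 + ∑ k : ZMod m, χ (r k)) (by simp) ?_ ?_
  · intro χ ψ hχ hψ
    simp only [Pi.add_apply, add_mul, Finset.sum_add_distrib, mul_add] at hχ hψ ⊢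
    linear_combination hχ + hψ
  · intro W _ _ _ ρ hρ
    have h := FDRep.sum_finrank_hom_of_isIrreducible hsimple hdistinct hall ρ hρ
    have h' : ∑ i, (finrank ℂ (S i ⟶ FDRep.of ρ) : ℂ) = 1 := by exact_mod_cast h
    simp_rw [← FDRep.scalar_product_char_eq_finrank_equivariant] at h'
    rw [sum_character_r_of_isIrreducible hodd hρ]
    exact (congrArg (2 * (m : ℂ) * ·) h').trans (mul_one _)

theorem norm_character_r_lt_two (hm : m ≠ 0) (hm1 : m ≠ 1) (hodd : Odd m)
    {V : FDRep ℂ (DihedralGroup m)} (hfaith : Function.Injective V.ρ)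
    (hdim : finrank ℂ V.V = 2) {k : ZMod m} (hk : k ≠ 0) : ‖V.character (r k)‖ < 2 := by
  have hpow : V.ρ (r k) ^ m = 1 := by
    rw [← map_pow, r_pow, CharP.cast_eq_zero, mul_zero, r_zero, map_one]
  refine (Module.End.norm_trace_lt_two_or_eq_smul_one hdim hm hpow).resolve_right ?_
  rintro ⟨c, hc⟩
  have hcenter : r k ∈ Subgroup.center (DihedralGroup m) := by
    rw [Subgroup.mem_center_iff]
    intro g
    apply hfaith
    rw [map_mul, map_mul, hc, mul_smul_comm, smul_mul_assoc, mul_one, one_mul]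
  rw [center_eq_bot_of_odd_ne_one hodd hm1, Subgroup.mem_bot, one_def] at hcenter
  exact hk (r.inj hcenter)

end DihedralGroup

theorem character_tpow {k G : Type} [Field k] [Monoid G] (V : FDRep k G) (n : ℕ) :
    (tpow V n).character = V.character ^ n := by
  induction n with
  | zero =>
    ext g
    exact (LinearMap.trace_one k k).trans (by simp)
  | succ n ih => rw [tpow, FDRep.char_tensor, ih, pow_succ]

/-- For the dihedral group `G` of order `2m` with `m ≥ 3` odd and `V` any faithful
`2`-dimensional complex representation, the number `b n` of simple summands (with
multiplicity) of `V^{⊗n}` satisfies `b n ~ ((m+1)/(2m))·2^n`. -/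
theorem dihedral_tensor_power_asymptotics
    (m : ℕ) (hm : 3 ≤ m) (hodd : Odd m)
    (V : FDRep ℂ (DihedralGroup m)) (hfaith : Function.Injective V.ρ)
    (hdim : Module.finrank ℂ V.V = 2)
    {ι : Type} [Fintype ι] (S : ι → FDRep ℂ (DihedralGroup m))
    (hsimple : ∀ i, Simple (S i))
    (hdistinct : ∀ i j, Nonempty (S i ≅ S j) → i = j)
    (hall : ∀ W : FDRep ℂ (DihedralGroup m), Simple W → ∃ i, Nonempty (W ≅ S i))
    (b : ℕ → ℕ)
    (hb : ∀ n, b n = ∑ i, Module.finrank ℂ (S i ⟶ tpow V n)) :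
    Filter.Tendsto (fun n : ℕ => (b n : ℝ) / 2 ^ n) Filter.atTop
      (nhds ((m + 1) / (2 * m))) := by
  have : NeZero m := ⟨by omega⟩
  have hm0 : (m : ℂ) ≠ 0 := NeZero.ne _
  have hchar : V.character 1 = 2 := by
    rw [FDRep.char_one]
    exact_mod_cast hdim
  have hformula : ∀ n, ((b n : ℝ) / 2 ^ n : ℝ) =
      (m + 1 + ∑ k ∈ Finset.univ.erase (0 : ZMod m),
        (V.character (DihedralGroup.r k) / 2) ^ n) / (2 * m : ℂ) := by
    intro n
    have h := DihedralGroup.two_mul_sum_finrank_hom hodd hsimple hdistinct hall (tpow V n)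
    rw [← Nat.cast_sum, ← hb, character_tpow, ← Finset.add_sum_erase _ _ (Finset.mem_univ 0)] at h
    simp only [Pi.pow_apply, DihedralGroup.r_zero, hchar] at h
    simp_rw [div_pow, ← Finset.sum_div]
    push_cast
    field_simp
    linear_combination h
  have hlim : Filter.Tendsto (fun n : ℕ => (m + 1 + ∑ k ∈ Finset.univ.erase (0 : ZMod m),
      (V.character (DihedralGroup.r k) / 2) ^ n) / (2 * m : ℂ)) Filter.atTop
      (nhds ((m + 1 + ∑ k ∈ Finset.univ.erase (0 : ZMod m), 0) / (2 * m))) := by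
    refine (tendsto_const_nhds.add (tendsto_finsetSum _ fun k hk => ?_)).div_const _
    apply tendsto_pow_atTop_nhds_zero_of_norm_lt_one
    have := DihedralGroup.norm_character_r_lt_two (by omega) (by omega) hodd hfaith hdim
      (Finset.ne_of_mem_erase hk)
    rw [norm_div, Complex.norm_two]
    linarith
  simp_rw [← hformula, Finset.sum_const_zero, add_zero] at hlim
  refine Filter.tendsto_ofReal_iff.1 ?_
  push_cast at hlim ⊢
  exact hlim
end

section
/- Let p be a prime, m ≥ 1, G an extraspecial p-group of order p^{1+2m}, and V a simple complex G-representation of dimension p^m. Then the number b(n) of simple summands (with multiplicity) of V^{⊗n} satisfies b(n) = p^{mn} if p divides n, and b(n) = p^{m(n−1)} otherwise. -/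
open CategoryTheory MonoidalCategory

namespace FDRep

open Limits Module

section Decomposition

variable {k G : Type} [Field k] [Group G]

theorem isZero_of_finrank_eq_zero {X : FDRep k G} (h : finrank k X.V = 0) : IsZero X := by
  have : Subsingleton X.V := finrank_zero_iff.mp h
  rw [IsZero.iff_id_eq_zero]
  ext x
  exact Subsingleton.elim _ _

theorem finrank_biprod (X Y : FDRep k G) :
    finrank k (X ⊞ Y).V = finrank k X.V + finrank k Y.V := by
  let F := forget₂ (FDRep k G) (FGModuleCat k) ⋙ forget₂ (FGModuleCat k) (ModuleCat k)
  rw [← finrank_prod]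
  have := preservesBinaryBiproducts_of_preservesBiproducts F
  exact (F.mapBiprod X Y ≪≫ ModuleCat.biprodIsoProd _ _).toLinearEquiv.finrank_eq

theorem finrank_hom_biprod (T X Y : FDRep k G) :
    finrank k (T ⟶ X ⊞ Y) = finrank k (T ⟶ X) + finrank k (T ⟶ Y) := by
  rw [← finrank_prod]
  refine LinearEquiv.finrank_eq
    { toFun := fun f => (f ≫ biprod.fst, f ≫ biprod.snd)
      invFun := fun q => biprod.lift q.1 q.2
      map_add' := ?_
      map_smul' := ?_
      left_inv := ?_
      right_inv := ?_ }
  · intro f g; simp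
  · intro c f; simp
  · intro f; apply biprod.hom_ext <;> simp
  · rintro ⟨f, g⟩; simp

theorem finrank_eq_of_iso {X Y : FDRep k G} (e : X ≅ Y) : finrank k X.V = finrank k Y.V :=
  (isoToLinearEquiv e).finrank_eq

theorem finrank_hom_congr_right (T : FDRep k G) {X Y : FDRep k G} (e : X ≅ Y) :
    finrank k (T ⟶ X) = finrank k (T ⟶ Y) :=
  (Linear.homCongr k (Iso.refl T) e).finrank_eq

/-- A nonzero representation is simple or splits as a sum of two nonzero ones. -/
theorem simple_or_exists_iso_biprod [Finite G] [NeZero (Nat.card G : k)] (W : FDRep k G)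
    (hW : ¬ IsZero W) : Simple W ∨ ∃ X Y : FDRep k G, ¬ IsZero X ∧ ¬ IsZero Y ∧
      Nonempty (W ≅ X ⊞ Y) := by
  refine or_iff_not_imp_left.mpr fun hs => ?_
  by_contra! hc
  refine hs ⟨fun {X} f _ => ⟨?_, fun hf => ?_⟩⟩
  · rintro hf rfl
    exact hW ((isIsoZero_iff_source_target_isZero _ _).mp hf).2
  · have hS : (ShortComplex.mk f (cokernel.π f) (cokernel.condition f)).ShortExact :=
      { exact := ShortComplex.exact_cokernel f
        mono_f := inferInstance
        epi_g := inferInstance }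
    have hX : ¬ IsZero X := fun h => hf (h.eq_zero_of_src f)
    have hcok : IsZero (cokernel f) := by
      by_contra h
      have : Injective (ShortComplex.mk f (cokernel.π f) (cokernel.condition f)).X₁ :=
        inferInstanceAs (Injective X)
      exact (hc X (cokernel f) hX h).false hS.splittingOfInjective.isoBinaryBiproduct
    have : Epi f := Preadditive.epi_of_isZero_cokernel f hcok
    exact isIso_of_mono_of_epi f

theorem sum_finrank_hom_mul_finrank [Finite G] [NeZero (Nat.card G : k)] [IsAlgClosed k]
    {ι : Type} [Fintype ι] (S : ι → FDRep k G) (hsimple : ∀ i, Simple (S i))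
    (hdistinct : ∀ i j, Nonempty (S i ≅ S j) → i = j)
    (hall : ∀ W : FDRep k G, Simple W → ∃ i, Nonempty (W ≅ S i)) (W : FDRep k G) :
    ∑ i, finrank k (S i ⟶ W) * finrank k (S i).V = finrank k W.V := by
  classical
  induction hn : finrank k W.V using Nat.strong_induction_on generalizing W with
  | _ n ih =>
  subst hn
  by_cases hW : IsZero W
  · have h1 (i) : finrank k (S i ⟶ W) = 0 :=
      have : Subsingleton (S i ⟶ W) := ⟨fun f g => hW.eq_of_tgt f g⟩
      finrank_zero_of_subsingleton
    have h2 := finrank_biprod W W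
    rw [← finrank_eq_of_iso (hW.iso (Y := W ⊞ W) (by
      rw [biprod_isZero_iff]; exact ⟨hW, hW⟩))] at h2
    simp only [h1, zero_mul, Finset.sum_const_zero]
    omega
  · rcases simple_or_exists_iso_biprod W hW with hs | ⟨X, Y, hX, hY, ⟨e⟩⟩
    · obtain ⟨j, ⟨e⟩⟩ := hall W hs
      rw [finrank_eq_of_iso e, Finset.sum_eq_single j]
      · rw [finrank_hom_congr_right _ e, finrank_hom_simple_simple, if_pos ⟨Iso.refl _⟩, one_mul]
      · intro i _ hij
        rw [finrank_hom_congr_right _ e, finrank_hom_simple_simple,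
          if_neg fun h => hij (hdistinct i j h), zero_mul]
      · simp
    · have hXY := finrank_biprod X Y
      have hX0 : finrank k X.V ≠ 0 := fun h => hX (isZero_of_finrank_eq_zero h)
      have hY0 : finrank k Y.V ≠ 0 := fun h => hY (isZero_of_finrank_eq_zero h)
      have hWXY := finrank_eq_of_iso e
      simp only [finrank_hom_congr_right _ e, finrank_hom_biprod, add_mul,
        Finset.sum_add_distrib]
      rw [ih _ (by omega) X rfl, ih _ (by omega) Y rfl, hWXY, hXY]

end Decomposition

section Scalars

variable {G : Type} [Group G]

theorem exists_eq_smul_one_of_commute {k : Type} [Field k] [IsAlgClosed k] (X : FDRep k G)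
    [Simple X] (g : G) (h : ∀ x : G, Commute (X.ρ g) (X.ρ x)) : ∃ c : k, X.ρ g = c • 1 := by
  let f : X ⟶ X := ⟨Action.ρ X g, fun x => by
    ext v
    exact LinearMap.congr_fun (h x).eq v⟩
  obtain ⟨c, hc⟩ := endomorphism_simple_eq_smul_id k f
  refine ⟨c, ?_⟩
  ext v
  exact (congrArg (fun φ : X ⟶ X => φ.hom.hom.hom v) hc).symm

theorem nontrivial_of_simple {k : Type} [Field k] (X : FDRep k G) [Simple X] :
    Nontrivial X.V := by
  by_contra h
  rw [not_nontrivial_iff_subsingleton] at h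
  exact Simple.not_isZero X (isZero_of_finrank_eq_zero finrank_zero_of_subsingleton)

theorem char_mul_char_inv_of_scalar {k : Type} [Field k] (X : FDRep k G) [Simple X] (g : G)
    (c : k) (h : X.ρ g = c • 1) : X.character g * X.character g⁻¹ = (finrank k X.V : k) ^ 2 := by
  have := nontrivial_of_simple X
  have h1 : X.ρ g * X.ρ g⁻¹ = 1 := by rw [← map_mul, mul_inv_cancel, map_one]
  have hc : c ≠ 0 := by
    rintro rfl
    simp [h] at h1
  have h2 : X.ρ g⁻¹ = c⁻¹ • 1 := by
    rw [h, smul_mul_assoc, one_mul] at h1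
    rw [← h1, smul_smul, inv_mul_cancel₀ hc, one_smul]
  rw [character, character, h, h2, map_smul, map_smul, LinearMap.trace_one, smul_eq_mul,
    smul_eq_mul]
  field_simp

theorem finrank_eq_one_of_commute [Fintype G] (X : FDRep ℂ G) [hX : Simple X]
    (h : ∀ g x : G, Commute (X.ρ g) (X.ρ x)) : finrank ℂ X.V = 1 := by
  have h1 := (simple_iff_char_is_norm_one X).mp hX
  have h2 (g : G) : X.character g * X.character g⁻¹ = (finrank ℂ X.V : ℂ) ^ 2 := by
    obtain ⟨c, hc⟩ := exists_eq_smul_one_of_commute X g (h g)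
    exact char_mul_char_inv_of_scalar X g c hc
  simp only [h2, Finset.sum_const, Finset.card_univ, nsmul_eq_mul, ← Nat.card_eq_fintype_card]
    at h1
  have h3 : Nat.card G * finrank ℂ X.V ^ 2 = Nat.card G * 1 := by
    rw [mul_one]; exact_mod_cast h1
  have h4 := Nat.eq_of_mul_eq_mul_left Nat.card_pos h3
  simpa using h4

theorem exists_eq_smul_one_of_mem_center (X : FDRep ℂ G) [Simple X] {z : G}
    (hz : z ∈ Subgroup.center G) : ∃ c : ℂ, X.ρ z = c • 1 :=
  exists_eq_smul_one_of_commute X z fun x => by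
    rw [Commute, SemiconjBy, ← map_mul, ← map_mul, Subgroup.mem_center_iff.mp hz x]

open scoped commutatorElement in
theorem commutator_mem_center (habelian : ∀ x y : G ⧸ Subgroup.center G, x * y = y * x)
    (g h : G) : ⁅g, h⁆ ∈ Subgroup.center G := by
  rw [← QuotientGroup.eq_one_iff, ← QuotientGroup.mk'_apply, map_commutatorElement,
    commutatorElement_eq_one_iff_mul_comm]
  exact habelian _ _

open scoped commutatorElement in
theorem finrank_eq_one_of_center_trivial [Fintype G]
    (habelian : ∀ x y : G ⧸ Subgroup.center G, x * y = y * x) (X : FDRep ℂ G) [Simple X]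
    (h : ∀ z ∈ Subgroup.center G, X.ρ z = 1) : finrank ℂ X.V = 1 := by
  refine finrank_eq_one_of_commute X fun g x => ?_
  have h1 : g * x = ⁅g, x⁆ * (x * g) := by simp [commutatorElement_def]
  rw [Commute, SemiconjBy, ← map_mul, h1, map_mul, h _ (commutator_mem_center habelian g x),
    one_mul, map_mul]

open scoped commutatorElement in
theorem card_center_mul_finrank_sq [Fintype G]
    (habelian : ∀ x y : G ⧸ Subgroup.center G, x * y = y * x) (X : FDRep ℂ G) [hX : Simple X]
    (h : ∀ z ∈ Subgroup.center G, X.ρ z = 1 → z = 1) :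
    Nat.card (Subgroup.center G) * finrank ℂ X.V ^ 2 = Nat.card G := by
  classical
  have h1 := (simple_iff_char_is_norm_one X).mp hX
  have h2 (g : G) : X.character g * X.character g⁻¹ =
      if g ∈ Subgroup.center G then (finrank ℂ X.V : ℂ) ^ 2 else 0 := by
    split_ifs with hg
    · obtain ⟨c, hc⟩ := exists_eq_smul_one_of_mem_center X hg
      exact char_mul_char_inv_of_scalar X g c hc
    · rw [Subgroup.mem_center_iff] at hg
      push Not at hg
      obtain ⟨x, hx⟩ := hg
      have hz := commutator_mem_center habelian x g
      obtain ⟨c, hc⟩ := exists_eq_smul_one_of_mem_center X hz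
      have hc1 : c ≠ 1 := by
        rintro rfl
        rw [one_smul] at hc
        exact hx (commutatorElement_eq_one_iff_mul_comm.mp (h _ hz hc))
      have h3 : X.character g = c * X.character g := by
        conv_lhs => rw [← char_conj X g x]
        have : x * g * x⁻¹ = ⁅x, g⁆ * g := by simp [commutatorElement_def]
        rw [this, character, map_mul, hc, smul_mul_assoc, one_mul, map_smul, smul_eq_mul,
          character]
      have h4 : (c - 1) * X.character g = 0 := by linear_combination -h3
      rw [(mul_eq_zero.mp h4).resolve_left (sub_ne_zero.mpr hc1), zero_mul]
  simp only [h2] at h1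
  rw [← Finset.sum_filter, Finset.sum_const, nsmul_eq_mul, ← Fintype.card_subtype,
    ← Nat.card_eq_fintype_card] at h1
  exact_mod_cast h1

end Scalars

section TensorPower

variable {k G : Type} [Field k]

theorem finrank_tpow [Monoid G] (V : FDRep k G) (n : ℕ) :
    finrank k (tpow V n).V = finrank k V.V ^ n := by
  induction n with
  | zero => exact finrank_self k
  | succ n ih =>
    rw [pow_succ, ← ih]
    exact finrank_tensorProduct (R := k) (S := k) (M := (tpow V n).V) (M' := V.V)

theorem tpow_ρ_of_scalar [Monoid G] (V : FDRep k G) (g : G) (c : k) (h : V.ρ g = c • 1) (n : ℕ) :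
    (tpow V n).ρ g = c ^ n • 1 := by
  induction n with
  | zero => rw [pow_zero, one_smul]; rfl
  | succ n ih =>
    have h1 : (tpow V (n + 1)).ρ g = TensorProduct.map ((tpow V n).ρ g) (V.ρ g) := rfl
    rw [h1, ih, h, TensorProduct.map_smul_left, TensorProduct.map_smul_right, smul_smul,
      pow_succ]
    congr 1
    exact TensorProduct.map_one

theorem ρ_eq_of_hom_ne_zero [Group G] {X W : FDRep k G} [Simple X] {f : X ⟶ W} (hf : f ≠ 0)
    {g : G} {a c : k} (hX : X.ρ g = a • 1) (hW : W.ρ g = c • 1) : a = c := by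
  by_contra hac
  apply hf
  ext v
  have h1 : f.hom.hom.hom (X.ρ g v) = W.ρ g (f.hom.hom.hom v) :=
    congrArg (fun φ : X.V ⟶ W.V => φ.hom.hom v) (f.comm g)
  rw [hX, hW] at h1
  have h2 : (a - c) • f.hom.hom.hom v = 0 := by
    rw [sub_smul, sub_eq_zero]
    simpa using h1
  exact (smul_eq_zero.mp h2).resolve_left (sub_ne_zero.mpr hac)

end TensorPower

end FDRep

open FDRep in
/-- For an extraspecial `p`-group `G` of order `p^(1+2m)` (center of order `p`,
`G/Z(G)` elementary abelian) and `V` a simple complex representation of dimension `p^m`,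
the number `b n` of simple summands (with multiplicity) of `V^{⊗n}` equals `p^(m·n)`
if `p ∣ n` and `p^(m·(n-1))` otherwise. -/
theorem extraspecial_tensor_power_count
    (p : ℕ) (hp : p.Prime) (m : ℕ) (hm : 1 ≤ m)
    {G : Type} [Group G] [Fintype G]
    (hcard : Fintype.card G = p ^ (1 + 2 * m))
    (hcenter : Nat.card (Subgroup.center G) = p)
    (habelian : ∀ x y : G ⧸ Subgroup.center G, x * y = y * x)
    (helem : ∀ x : G ⧸ Subgroup.center G, x ^ p = 1)
    (V : FDRep ℂ G) (hVsimple : Simple V)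
    (hdim : Module.finrank ℂ V.V = p ^ m)
    {ι : Type} [Fintype ι] (S : ι → FDRep ℂ G)
    (hsimple : ∀ i, Simple (S i))
    (hdistinct : ∀ i j, Nonempty (S i ≅ S j) → i = j)
    (hall : ∀ W : FDRep ℂ G, Simple W → ∃ i, Nonempty (W ≅ S i))
    (b : ℕ → ℕ)
    (hb : ∀ n, b n = ∑ i, Module.finrank ℂ (S i ⟶ tpow V n)) :
    ∀ n : ℕ, b n = if p ∣ n then p ^ (m * n) else p ^ (m * (n - 1)) := by
  intro n
  have hsum := sum_finrank_hom_mul_finrank S hsimple hdistinct hall (tpow V n)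
  rw [finrank_tpow, hdim, ← pow_mul] at hsum
  choose! ω hω using fun z (hz : z ∈ Subgroup.center G) => exists_eq_smul_one_of_mem_center V hz
  have smul_one_inj {X : FDRep ℂ G} [Simple X] {a c : ℂ}
      (h : a • (1 : X.V →ₗ[ℂ] X.V) = c • 1) : a = c := by
    have := nontrivial_of_simple X
    exact smul_left_injective ℂ one_ne_zero h
  have hpow {z : G} (hz : z ∈ Subgroup.center G) : z ^ p = 1 := by
    have := pow_card_eq_one' (x := (⟨z, hz⟩ : Subgroup.center G))
    rw [hcenter] at this
    exact congrArg Subtype.val this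
  have hωp {z : G} (hz : z ∈ Subgroup.center G) : ω z ^ p = 1 := by
    apply smul_one_inj (X := V)
    have h1 := map_pow V.ρ z p
    rw [hpow hz, map_one, hω z hz, smul_pow, one_pow] at h1
    rw [← h1, one_smul]
  have hωinj {z : G} (hz : z ∈ Subgroup.center G) (h1 : ω z = 1) : z = 1 := by
    by_contra hne
    have hd : Module.finrank ℂ V.V = 1 := by
      refine finrank_eq_one_of_center_trivial habelian V fun y hy => ?_
      have : Fact p.Prime := ⟨hp⟩
      obtain ⟨j, hj⟩ := Subgroup.mem_zpowers_iff.mp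
        (mem_zpowers_of_prime_card (g := (⟨z, hz⟩ : Subgroup.center G)) (g' := ⟨y, hy⟩) hcenter
          (fun h => hne (congrArg Subtype.val h)))
      have hj' : z ^ j = y := congrArg Subtype.val hj
      have hz1 : z ∈ V.ρ.ker := by
        rw [MonoidHom.mem_ker, hω z hz, h1, one_smul]
      exact hj' ▸ V.ρ.ker.zpow_mem hz1 j
    rw [hdim] at hd
    exact (Nat.one_lt_pow (by omega) hp.one_lt).ne' hd
  have key {i : ι} (hi : Module.finrank ℂ (S i ⟶ tpow V n) ≠ 0) {z : G}
      (hz : z ∈ Subgroup.center G) : (S i).ρ z = ω z ^ n • 1 := by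
    have := hsimple i
    obtain ⟨f, hf⟩ := Module.finrank_pos_iff_exists_ne_zero.mp (Nat.pos_of_ne_zero hi)
    obtain ⟨a, ha⟩ := exists_eq_smul_one_of_mem_center (S i) hz
    rw [ha, ρ_eq_of_hom_ne_zero hf ha (tpow_ρ_of_scalar V z (ω z) (hω z hz) n)]
  have hmul {d : ℕ} (hd : ∀ i, Module.finrank ℂ (S i ⟶ tpow V n) ≠ 0 → Module.finrank ℂ (S i).V = d) :
      b n * d = p ^ (m * n) := by
    rw [hb, ← hsum, Finset.sum_mul]
    refine Finset.sum_congr rfl fun i _ => ?_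
    by_cases hi : Module.finrank ℂ (S i ⟶ tpow V n) = 0
    · rw [hi, zero_mul, zero_mul]
    · rw [hd i hi]
  split_ifs with hpn
  · rw [← hmul (d := 1), mul_one]
    intro i hi
    have := hsimple i
    refine finrank_eq_one_of_center_trivial habelian (S i) fun z hz => ?_
    obtain ⟨q, rfl⟩ := hpn
    rw [key hi hz, pow_mul, hωp hz, one_pow, one_smul]
  · have h1 : b n * p ^ m = p ^ (m * n) := by
      refine hmul fun i hi => ?_
      have := hsimple i
      have h2 := card_center_mul_finrank_sq habelian (S i) fun z hz hz1 => by
        apply hωinj hz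
        rw [key hi hz] at hz1
        have h3 : ω z ^ n = 1 := smul_one_inj (X := S i) (by rw [hz1, one_smul])
        have h4 := pow_gcd_eq_one.mpr ⟨hωp hz, h3⟩
        rwa [Nat.Coprime.gcd_eq_one ((Nat.Prime.coprime_iff_not_dvd hp).mpr hpn), pow_one] at h4
      rw [hcenter, Nat.card_eq_fintype_card, hcard, pow_add, pow_one, mul_comm 2 m, pow_mul] at h2
      exact Nat.pow_left_injective two_ne_zero (Nat.eq_of_mul_eq_mul_left hp.pos h2)
    obtain ⟨r, rfl⟩ : ∃ r, n = r + 1 :=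
      Nat.exists_eq_succ_of_ne_zero fun h => hpn (h ▸ dvd_zero p)
    rw [mul_add, mul_one, pow_add] at h1
    exact Nat.eq_of_mul_eq_mul_right (pow_pos hp.pos m) h1
end

section
/- Let G = SL_2(F_p) for a prime p > 2, V = F_p² its natural 2-dimensional representation over F_p, and b(n) the number of indecomposable summands (with multiplicity) of V^{⊗n}. Then b(n) is asymptotically equal to a(n) = (1/(2p−2) + (−1)^n/(2p²−2p)) · 2^n, i.e. b(n)/a(n) → 1 as n → ∞. -/
open CategoryTheory MonoidalCategory Limits

noncomputable instance {k G : Type} [Field k] [Group G] : HasFiniteBiproducts (FDRep k G) :=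
  HasFiniteBiproducts.of_hasFiniteProducts

noncomputable instance {k G : Type} [Field k] [Group G] : HasBinaryBiproducts (FDRep k G) :=
  hasBinaryBiproducts_of_finite_biproducts _

/-- The natural `2`-dimensional representation of `SL₂(F_p)` over `F_p`. -/
noncomputable def natRep (p : ℕ) [Fact p.Prime] :
    Representation (ZMod p) (Matrix.SpecialLinearGroup (Fin 2) (ZMod p)) (Fin 2 → ZMod p) :=
  (LinearEquiv.automorphismGroup.toLinearMapMonoidHom).comp
    Matrix.SpecialLinearGroup.toLin'

namespace SLTwo
open Matrix

variable {p : ℕ} [Fact p.Prime]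

/-- The upper unitriangular matrix with off-diagonal entry `t`. -/
def unip (t : ZMod p) : SpecialLinearGroup (Fin 2) (ZMod p) :=
  ⟨!![1, t; 0, 1], by simp [det_fin_two_of]⟩

/-- The diagonal matrix with entries `a` and `a⁻¹`. -/
def torus (a : (ZMod p)ˣ) : SpecialLinearGroup (Fin 2) (ZMod p) :=
  ⟨!![(a : ZMod p), 0; 0, (a : ZMod p)⁻¹], by simp [det_fin_two_of, -ZMod.inv_coe_unit]⟩

/-- The Weyl element. -/
def weyl : SpecialLinearGroup (Fin 2) (ZMod p) :=
  ⟨!![0, -1; 1, 0], by simp [det_fin_two_of]⟩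

lemma unip_coe (t : ZMod p) : (unip t : Matrix (Fin 2) (Fin 2) (ZMod p)) = !![1, t; 0, 1] := rfl

lemma torus_coe (a : (ZMod p)ˣ) :
    (torus a : Matrix (Fin 2) (Fin 2) (ZMod p)) = !![(a : ZMod p), 0; 0, (a : ZMod p)⁻¹] := rfl

lemma weyl_coe : (weyl : SpecialLinearGroup (Fin 2) (ZMod p)) =
    (!![0, -1; 1, 0] : Matrix (Fin 2) (Fin 2) (ZMod p)) := rfl

lemma unip_mul_unip (s t : ZMod p) : unip s * unip t = unip (s + t) := by
  ext i j
  fin_cases i <;> fin_cases j <;> simp [unip_coe, Matrix.mul_apply, Fin.sum_univ_two, add_comm]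

lemma unip_zero : unip (0 : ZMod p) = 1 := by
  ext i j
  fin_cases i <;> fin_cases j <;> simp [unip_coe]

lemma unip_one_pow (n : ℕ) : unip (1 : ZMod p) ^ n = unip (n : ZMod p) := by
  induction n with
  | zero => simp [unip_zero]
  | succ n ih => rw [pow_succ, ih, unip_mul_unip]; push_cast; rfl

lemma torus_mul_torus (a b : (ZMod p)ˣ) : torus a * torus b = torus (a * b) := by
  ext i j
  fin_cases i <;> fin_cases j <;>
    simp [torus_coe, -ZMod.inv_coe_unit, Matrix.mul_apply, Fin.sum_univ_two, mul_comm]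

lemma torus_one : torus (1 : (ZMod p)ˣ) = 1 := by
  ext i j
  fin_cases i <;> fin_cases j <;> simp [torus_coe]

lemma torus_mul_unip (a : (ZMod p)ˣ) (t : ZMod p) :
    torus a * unip t = unip ((a : ZMod p) ^ 2 * t) * torus a := by
  ext i j
  fin_cases i <;> fin_cases j <;>
    simp [torus_coe, unip_coe, -ZMod.inv_coe_unit, Matrix.mul_apply, Fin.sum_univ_two]
  have := a.ne_zero
  field_simp

lemma bruhat_of_ne_zero (g : SpecialLinearGroup (Fin 2) (ZMod p)) (hg : g 1 0 ≠ 0) :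
    g = unip (g 0 0 / g 1 0) * (torus (Units.mk0 _ hg)⁻¹ * (weyl * unip (g 1 1 / g 1 0))) := by
  have h := g.det_coe
  rw [det_fin_two] at h
  ext i j
  fin_cases i <;> fin_cases j <;>
    simp [torus_coe, unip_coe, weyl_coe, -ZMod.inv_coe_unit, Matrix.mul_apply, Fin.sum_univ_two] <;> field_simp
  linear_combination -h

lemma bruhat_of_eq_zero (g : SpecialLinearGroup (Fin 2) (ZMod p)) (hg : g 1 0 = 0) :
    ∃ a : (ZMod p)ˣ, (a : ZMod p)⁻¹ = g 1 1 ∧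
      g = unip (g 0 0 * g 0 1) * torus a := by
  have h := g.det_coe
  rw [det_fin_two, hg, mul_zero, sub_zero] at h
  refine ⟨⟨g 0 0, g 1 1, h, by rw [mul_comm]; exact h⟩,
    inv_eq_of_mul_eq_one_right h, ?_⟩
  ext i j
  fin_cases i <;> fin_cases j <;>
    simp [torus_coe, unip_coe, -ZMod.inv_coe_unit, Matrix.mul_apply, Fin.sum_univ_two, hg, inv_eq_of_mul_eq_one_right h]
  linear_combination (-(g.1 0 1)) * h

/-- Functions on `SL₂` that are homogeneous of degree `r` functions of the bottom row. -/
def IsHomog (r : ℕ) (f : SpecialLinearGroup (Fin 2) (ZMod p) → ZMod p) : Prop :=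
  (∀ t g, f (unip t * g) = f g) ∧
    ∀ (a : (ZMod p)ˣ) g, f (torus a * g) = (a : ZMod p)⁻¹ ^ r * f g

lemma right_unip_invariant {f : SpecialLinearGroup (Fin 2) (ZMod p) → ZMod p}
    (h : ∀ g, f (g * unip 1) = f g) (t : ZMod p) (g) : f (g * unip t) = f g := by
  rw [← ZMod.natCast_zmod_val t, ← unip_one_pow]
  induction t.val with
  | zero => simp
  | succ n ih => rw [pow_succ, ← mul_assoc, h, ih]

lemma IsHomog.apply_eq {r : ℕ} {f : SpecialLinearGroup (Fin 2) (ZMod p) → ZMod p}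
    (hf : IsHomog r f) (h : ∀ g, f (g * unip 1) = f g)
    (g : SpecialLinearGroup (Fin 2) (ZMod p)) :
    f g = if g 1 0 = 0 then f 1 * g 1 1 ^ r else f weyl * g 1 0 ^ r := by
  split_ifs with hg
  · obtain ⟨a, ha, hg'⟩ := bruhat_of_eq_zero g hg
    conv_lhs => rw [hg']
    rw [hf.1, ← mul_one (torus a), hf.2, ha, mul_comm]
  · conv_lhs => rw [bruhat_of_ne_zero g hg]
    rw [hf.1, hf.2, right_unip_invariant h, mul_comm]
    simp

/-- The `r`-th power of the lower left entry. -/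
def lowPow (r : ℕ) : SpecialLinearGroup (Fin 2) (ZMod p) → ZMod p := fun g => g 1 0 ^ r

lemma lowPow_isHomog (r : ℕ) : IsHomog r (lowPow (p := p) r) := by
  refine ⟨fun t g => ?_, fun a g => ?_⟩
  · simp [lowPow, unip_coe, Matrix.mul_apply, Fin.sum_univ_two]
  · simp [lowPow, torus_coe, -ZMod.inv_coe_unit, Matrix.mul_apply, Fin.sum_univ_two, mul_pow]

lemma lowPow_mul_unip (r : ℕ) (t : ZMod p) (g) : lowPow r (g * unip t) = lowPow r g := by
  simp [lowPow, unip_coe, Matrix.mul_apply, Fin.sum_univ_two]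

lemma sum_pow_eq {r : ℕ} (hr : 1 ≤ r) (hr' : r ≤ p - 1) :
    ∑ s : ZMod p, s ^ r = if r = p - 1 then -1 else 0 := by
  split_ifs with h
  · subst h
    have h1 : ∀ s : ZMod p, s ^ (p - 1) = if s = 0 then 0 else 1 := by
      intro s
      split_ifs with hs
      · rw [hs, zero_pow (by omega)]
      · exact ZMod.pow_card_sub_one_eq_one hs
    have := (Fact.out : p.Prime).one_lt
    rw [Finset.sum_congr rfl fun s _ => h1 s]
    simp [Finset.sum_ite, Finset.filter_ne', Finset.card_erase_of_mem, ZMod.card]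
    rw [Nat.cast_sub (by omega)]; simp
  · apply FiniteField.sum_pow_lt_card_sub_one
    rw [ZMod.card]; omega

lemma sum_affine (c d : ZMod p) (hc : c ≠ 0) (φ : ZMod p → ZMod p) :
    ∑ t : ZMod p, φ (d + t * c) = ∑ s, φ s := by
  apply Fintype.sum_bijective (fun t => d + t * c)
  · rw [← Finite.injective_iff_bijective]
    intro x y h
    simpa [hc] using h
  · simp

/-- Averaging over the upper unipotent subgroup after translating by the Weyl element. -/
lemma sum_unip_weyl {r : ℕ} (hr : 1 ≤ r) (hr' : r ≤ p - 1)
    {f : SpecialLinearGroup (Fin 2) (ZMod p) → ZMod p}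
    (hf : IsHomog r f) (h : ∀ g, f (g * unip 1) = f g)
    (g : SpecialLinearGroup (Fin 2) (ZMod p)) :
    ∑ t : ZMod p, f (g * (unip t * weyl)) =
      (f 1 * (-1) ^ r - if r = p - 1 then f weyl else 0) * lowPow r g := by
  have e : ∀ t, f (g * (unip t * weyl)) =
      (fun s => if s = 0 then f 1 * (-(g 1 0)) ^ r else f weyl * s ^ r) (g 1 1 + t * g 1 0) := by
    intro t
    rw [hf.apply_eq h]
    have h1 : (g * (unip t * weyl)).1 1 0 = g 1 1 + t * g 1 0 := by
      simp [unip_coe, weyl_coe, Matrix.mul_apply, Fin.sum_univ_two]; ring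
    have h2 : (g * (unip t * weyl)).1 1 1 = - g 1 0 := by
      simp [unip_coe, weyl_coe, Matrix.mul_apply, Fin.sum_univ_two]
    rw [h1, h2]
  rw [Finset.sum_congr rfl fun t _ => e t]
  by_cases hc : g 1 0 = 0
  · have : (0 : ZMod p) ^ r = 0 := zero_pow (by omega)
    simp [hc, lowPow, this]
  · rw [sum_affine _ _ hc (fun s => if s = 0 then f 1 * (-(g 1 0)) ^ r else f weyl * s ^ r)]
    have e2 : ∀ s : ZMod p, (if s = 0 then f 1 * (-(g 1 0)) ^ r else f weyl * s ^ r) =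
        (if s = 0 then f 1 * (-(g 1 0)) ^ r else 0) + f weyl * s ^ r := by
      intro s
      split_ifs with hs
      · rw [hs, zero_pow (by omega)]; simp
      · simp
    rw [Finset.sum_congr rfl fun s _ => e2 s, Finset.sum_add_distrib, ← Finset.mul_sum,
      sum_pow_eq hr hr', neg_pow]
    simp only [Finset.sum_ite_eq', Finset.mem_univ, if_true, lowPow]
    split_ifs with hrp
    · subst hrp
      rw [ZMod.pow_card_sub_one_eq_one hc]; ring
    · ring

end SLTwo

namespace SLTwo
noncomputable section
open Matrix

variable {p : ℕ} [Fact p.Prime]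

/-- The space of functions on `SL₂(F_p)`. -/
abbrev Fn (p : ℕ) : Type := SpecialLinearGroup (Fin 2) (ZMod p) → ZMod p

/-- Left translation of functions. -/
def leftTr (h : SpecialLinearGroup (Fin 2) (ZMod p)) : Module.End (ZMod p) (Fn p) :=
  LinearMap.funLeft (ZMod p) (ZMod p) fun g => h⁻¹ * g

lemma leftTr_apply (h g : SpecialLinearGroup (Fin 2) (ZMod p)) (f : Fn p) :
    leftTr h f g = f (h⁻¹ * g) := rfl

variable (p) in
/-- The endomorphisms of the space of functions commuting with left translations. -/
def algSub : Subalgebra (ZMod p) (Module.End (ZMod p) (Fn p)) :=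
  Subalgebra.centralizer (ZMod p) (Set.range leftTr)

variable (p) in
/-- The ring underlying `algSub`. -/
def Alg : Type := algSub p

instance : Ring (Alg p) := inferInstanceAs (Ring (algSub p))
instance : Algebra (ZMod p) (Alg p) := inferInstanceAs (Algebra (ZMod p) (algSub p))
instance : Module (Alg p) (Fn p) := inferInstanceAs (Module (algSub p) (Fn p))
instance : IsScalarTower (ZMod p) (Alg p) (Fn p) :=
  inferInstanceAs (IsScalarTower (ZMod p) (algSub p) (Fn p))
instance : SMulCommClass (Alg p) (ZMod p) (Fn p) :=
  ⟨fun a c f => map_smul a.1 c f⟩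
instance : FaithfulSMul (Alg p) (Fn p) := inferInstanceAs (FaithfulSMul (algSub p) (Fn p))
instance : Module.Finite (ZMod p) (Alg p) := inferInstanceAs (Module.Finite (ZMod p) (algSub p))
instance : Nontrivial (Alg p) := inferInstanceAs (Nontrivial (algSub p))

lemma alg_smul_eq (a : Alg p) (f : Fn p) : a • f = a.1 f := rfl

lemma leftTr_smul (a : Alg p) (h : SpecialLinearGroup (Fin 2) (ZMod p)) (f : Fn p) :
    leftTr h (a • f) = a • leftTr h f := by
  have := Subalgebra.mem_centralizer_iff _ |>.1 a.2
  exact congrArg (fun x : Module.End (ZMod p) (Fn p) => x f) (this _ ⟨h, rfl⟩)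

/-- Right translation of functions. -/
def rightTr : SpecialLinearGroup (Fin 2) (ZMod p) →* Alg p where
  toFun h := ⟨LinearMap.funLeft (ZMod p) (ZMod p) fun g => g * h, by
    rw [algSub, Subalgebra.mem_centralizer_iff]
    rintro _ ⟨x, rfl⟩
    ext f g
    simp [leftTr, LinearMap.funLeft, mul_assoc]⟩
  map_one' := Subtype.ext <| LinearMap.ext fun f => funext fun g => congrArg f (mul_one g)
  map_mul' x y := Subtype.ext <| LinearMap.ext fun f => funext fun g =>
    congrArg f (mul_assoc g x y).symm

lemma rightTr_smul_apply (h g : SpecialLinearGroup (Fin 2) (ZMod p)) (f : Fn p) :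
    (rightTr h • f) g = f (g * h) := rfl

lemma exists_eq_sum_rightTr (a : Alg p) : ∃ c : SpecialLinearGroup (Fin 2) (ZMod p) → ZMod p,
    a = ∑ x, c x • rightTr x := by
  refine ⟨fun x => (a • (Pi.single x 1 : Fn p)) 1, ?_⟩
  have key : ∀ f : Fn p, (a • f) 1 = ∑ x, f x * (a • (Pi.single x 1 : Fn p)) 1 := by
    intro f
    conv_lhs => rw [pi_eq_sum_univ' f]
    rw [alg_smul_eq, map_sum, Finset.sum_apply]
    refine Finset.sum_congr rfl fun x _ => ?_
    rw [map_smul]; rfl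
  apply Subtype.ext
  refine LinearMap.ext fun f => funext fun g => ?_
  have h1 : (a • f) g = (a • leftTr g⁻¹ f) 1 := by
    rw [← leftTr_smul, leftTr_apply]; simp
  change (a • f) g = ((∑ x, _ : Alg p) • f) g
  rw [h1, key, Finset.sum_smul, Finset.sum_apply]
  refine Finset.sum_congr rfl fun x _ => ?_
  rw [smul_assoc, Pi.smul_apply, rightTr_smul_apply, leftTr_apply, smul_eq_mul, mul_comm]
  simp

lemma rightTr_unip_sub_one_isNilpotent : IsNilpotent (rightTr (unip (1 : ZMod p)) - 1) := by
  have : CharP (Alg p) p := charP_of_injective_algebraMap (algebraMap (ZMod p) (Alg p)).injective p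
  refine ⟨p, ?_⟩
  rw [sub_pow_char_of_commute _ (Commute.one_right _), one_pow, ← map_pow, unip_one_pow, CharP.cast_eq_zero,
    unip_zero, map_one, sub_self]

section
variable {R S : Type*} [Ring R] [AddCommGroup S] [Module R S]

lemma exists_smul_eq_zero_of_isNilpotent {u : R} (hu : IsNilpotent u) {s : S} (hs : s ≠ 0) :
    ∃ n : ℕ, u ^ n • s ≠ 0 ∧ u • u ^ n • s = 0 := by
  classical
  obtain ⟨n, hn⟩ := hu
  have h : ∃ n, u ^ n • s = 0 := ⟨n, by rw [hn, zero_smul]⟩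
  obtain ⟨m, hm⟩ : ∃ m, Nat.find h = m + 1 := by
    refine Nat.exists_eq_succ_of_ne_zero fun h0 => hs ?_
    have := Nat.find_spec h
    rwa [h0, pow_zero, one_smul] at this
  refine ⟨m, Nat.find_min h (by omega), ?_⟩
  rw [smul_smul, ← pow_succ', ← hm]
  exact Nat.find_spec h

lemma exists_forall_ne_smul_of_isNilpotent [Nontrivial S] {u : R} (hu : IsNilpotent u) :
    ∃ s : S, ∀ s', u • s' ≠ s := by
  by_contra! h
  obtain ⟨n, hn⟩ := hu
  have h2 : ∀ n (s : S), ∃ s', u ^ n • s' = s := by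
    intro n
    induction n with
    | zero => exact fun s => ⟨s, by simp⟩
    | succ n ih =>
      intro s
      obtain ⟨s1, h1⟩ := ih s
      obtain ⟨s2, h2⟩ := h s1
      exact ⟨s2, by rw [pow_succ, mul_smul, h2, h1]⟩
  obtain ⟨s, hs⟩ := exists_ne (0 : S)
  obtain ⟨s', h'⟩ := h2 n s
  rw [hn, zero_smul] at h'
  exact hs h'.symm

end

lemma exists_unip_fixed {S : Type*} [AddCommGroup S] [Module (Alg p) S] {N : Submodule (Alg p) S}
    (hN : N ≠ ⊥) : ∃ s ∈ N, s ≠ 0 ∧ rightTr (unip (1 : ZMod p)) • s = s := by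
  obtain ⟨s, hs, hs0⟩ := Submodule.exists_mem_ne_zero_of_ne_bot hN
  obtain ⟨n, h1, h2⟩ := exists_smul_eq_zero_of_isNilpotent
    (rightTr_unip_sub_one_isNilpotent (p := p)) hs0
  refine ⟨_, N.smul_mem _ hs, h1, ?_⟩
  rwa [sub_smul, one_smul, sub_eq_zero] at h2

/-- Homogeneous functions form a submodule. -/
def homog (r : ℕ) : Submodule (Alg p) (Fn p) where
  carrier := {f | IsHomog r f}
  add_mem' {f f'} h h' := ⟨fun t g => by simp [h.1 t g, h'.1 t g],
    fun a g => by simp only [Pi.add_apply, h.2 a g, h'.2 a g, mul_add]⟩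
  zero_mem' := ⟨fun t g => rfl, fun a g => (mul_zero _).symm⟩
  smul_mem' a f h := by
    refine ⟨fun t g => ?_, fun b g => ?_⟩
    · have h1 : leftTr (unip t)⁻¹ f = f := by
        ext g; rw [leftTr_apply, inv_inv, h.1]
      have h2 := congrFun (leftTr_smul a (unip t)⁻¹ f) g
      rwa [h1, leftTr_apply, inv_inv] at h2
    · have h1 : leftTr (torus b)⁻¹ f = (b : ZMod p)⁻¹ ^ r • f := by
        ext g; rw [leftTr_apply, inv_inv, h.2]; rfl
      have h2 := congrFun (leftTr_smul a (torus b)⁻¹ f) g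
      rwa [h1, leftTr_apply, inv_inv, smul_comm] at h2

/-- The submodule generated by a power of the lower left entry. -/
def lowMod (r : ℕ) : Submodule (Alg p) (Fn p) := Submodule.span (Alg p) {lowPow r}

lemma lowPow_mem (r : ℕ) : lowPow r ∈ lowMod (p := p) r := Submodule.mem_span_singleton_self _

lemma lowMod_le_homog (r : ℕ) : lowMod (p := p) r ≤ homog r := by
  rw [lowMod, Submodule.span_singleton_le_iff_mem]
  exact lowPow_isHomog r

lemma lowPow_ne_zero (r : ℕ) : lowPow (p := p) r ≠ 0 := by
  intro h
  have := congrFun h weyl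
  simp [lowPow, weyl_coe] at this

lemma weyl_mul_unip_mul (t : ZMod p) (g : SpecialLinearGroup (Fin 2) (ZMod p)) :
    (weyl * (unip t * g)).1 1 0 = g 0 0 + t * g 1 0 := by
  simp [unip_coe, weyl_coe, Matrix.mul_apply, Fin.sum_univ_two, Matrix.vecMul, dotProduct]

lemma sum_weyl_unip_of_mem {s : ℕ} (hs : 1 ≤ s) (hs' : s ≤ p - 1) {f : Fn p} (hf : f ∈ lowMod s)
    (g : SpecialLinearGroup (Fin 2) (ZMod p)) :
    ∑ t : ZMod p, f (weyl * (unip t * g)) + (if s = p - 1 then f g else 0) = 0 := by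
  let Θ : Fn p →ₗ[Alg p] Fn p :=
    { toFun f := ∑ t : ZMod p, leftTr (weyl * unip t)⁻¹ f + (if s = p - 1 then 1 else 0 : ℤ) • f
      map_add' f f' := by simp [Finset.sum_add_distrib]; abel
      map_smul' a f := by
        simp only [leftTr_smul, smul_add, Finset.smul_sum, RingHom.id_apply]
        rw [smul_comm a] }
  have hΘ : ∀ f g, Θ f g =
      ∑ t : ZMod p, f (weyl * (unip t * g)) + (if s = p - 1 then f g else 0) := by
    intro f g
    simp only [Θ, LinearMap.coe_mk, AddHom.coe_mk, Pi.add_apply, Finset.sum_apply, leftTr_apply,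
      inv_inv, mul_assoc]
    split_ifs <;> simp
  rw [← hΘ]
  suffices h : Θ (lowPow s) = 0 by
    have : lowMod s ≤ LinearMap.ker Θ := by
      rw [lowMod, Submodule.span_singleton_le_iff_mem]; exact h
    rw [this hf]; rfl
  ext g
  rw [hΘ]
  simp only [lowPow, weyl_mul_unip_mul]
  by_cases hc : g 1 0 = 0
  · simp only [hc, mul_zero, add_zero, zero_pow (show s ≠ 0 by omega)]
    simp
  · rw [sum_affine _ _ hc (fun x => x ^ s), sum_pow_eq hs hs']
    split_ifs with h
    · rw [h, ZMod.pow_card_sub_one_eq_one hc]; simp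
    · simp

lemma eq_smul_lowPow {s : ℕ} (hs' : s ≤ p - 1) {f : Fn p} (hf : f ∈ lowMod s)
    (h : rightTr (unip (1 : ZMod p)) • f = f) : f = f weyl • lowPow s := by
  have h0 : ∀ g, f (g * unip 1) = f g := fun g => congrFun h g
  have hh : IsHomog s f := lowMod_le_homog s hf
  rcases Nat.eq_zero_or_pos s with rfl | hs
  · obtain ⟨a, rfl⟩ := Submodule.mem_span_singleton.1 hf
    obtain ⟨c, rfl⟩ := exists_eq_sum_rightTr a
    ext g
    simp only [Finset.sum_smul, Finset.sum_apply, smul_assoc, Pi.smul_apply, rightTr_smul_apply,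
      lowPow, pow_zero]
    simp
  · have hsum := sum_weyl_unip_of_mem hs hs' hf
    have hp := (Fact.out : p.Prime).one_lt
    have h1 : f 1 = 0 := by
      by_cases hsp : s = p - 1
      · have := hsum 1
        simp only [mul_one, right_unip_invariant h0, if_pos hsp] at this
        simpa using this
      · have := hsum weyl
        have h11 : ∀ t : ZMod p, (weyl * (unip t * weyl)).1 1 1 = -1 := by
          intro t
          simp [unip_coe, weyl_coe, Matrix.mul_apply, Fin.sum_univ_two]
        have h3 := sum_pow_eq hs hs'
        rw [if_neg hsp] at h3
        rw [if_neg hsp, add_zero] at this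
        have e : ∀ t : ZMod p, f (weyl * (unip t * weyl)) =
            (if t = 0 then f 1 * (-1) ^ s else 0) + f weyl * t ^ s := by
          intro t
          rw [hh.apply_eq h0, weyl_mul_unip_mul, h11]
          simp only [weyl_coe, of_apply, cons_val', cons_val_zero, cons_val_one, cons_val_fin_one]
          split_ifs with ht1 ht2 ht2
          · rw [ht2, zero_pow (by omega)]; simp
          · simp [ht2] at ht1
          · simp [ht2] at ht1
          · simp
        rw [Finset.sum_congr rfl fun t _ => e t, Finset.sum_add_distrib, ← Finset.mul_sum, h3] at this
        simpa using this
    ext g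
    rw [hh.apply_eq h0 g, h1]
    simp only [Pi.smul_apply, smul_eq_mul, lowPow, zero_mul]
    split_ifs with hg
    · rw [hg, zero_pow (by omega), mul_zero]
    · rfl

lemma lowMod_isAtom {s : ℕ} (hs : s ≤ p - 1) : IsAtom (lowMod (p := p) s) := by
  refine ⟨fun h => lowPow_ne_zero (p := p) s ?_, fun N hN => ?_⟩
  · have := lowPow_mem (p := p) s
    rwa [h, Submodule.mem_bot] at this
  · by_contra hne
    obtain ⟨f, hf, hf0, hfix⟩ := exists_unip_fixed hne
    have e := eq_smul_lowPow hs (hN.le hf) hfix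
    have hc : f weyl ≠ 0 := fun h => hf0 (by rw [e, h, zero_smul])
    refine hN.not_ge ?_
    rw [lowMod, Submodule.span_singleton_le_iff_mem]
    have : lowPow s = (f weyl)⁻¹ • f := by
      generalize f weyl = c at e hc
      rw [e]
      rw [smul_smul, inv_mul_cancel₀ hc, one_smul]
    rw [this]
    exact N.smul_of_tower_mem _ hf

end

end SLTwo

namespace SLTwo
noncomputable section
open Matrix

variable {p : ℕ} [Fact p.Prime]

lemma exists_unip_invariant_functional (S : Type*) [AddCommGroup S] [Module (Alg p) S]
    [Module (ZMod p) S] [IsScalarTower (ZMod p) (Alg p) S] [Nontrivial S] :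
    ∃ l : S →ₗ[ZMod p] ZMod p, l ≠ 0 ∧
      ∀ s, l (rightTr (unip (1 : ZMod p)) • s) = l s := by
  obtain ⟨s, hs⟩ := exists_forall_ne_smul_of_isNilpotent (S := S)
    (rightTr_unip_sub_one_isNilpotent (p := p))
  have hlt : LinearMap.range (Algebra.lsmul (ZMod p) (ZMod p) S
      (rightTr (unip (1 : ZMod p)) - 1)) < ⊤ := by
    rw [lt_top_iff_ne_top]
    intro h
    obtain ⟨s', h'⟩ := LinearMap.range_eq_top.1 h s
    exact hs s' h'
  obtain ⟨l, hl0, hl⟩ := Submodule.exists_le_ker_of_lt_top _ hlt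
  refine ⟨l, hl0, fun s => ?_⟩
  have : l ((rightTr (unip (1 : ZMod p)) - 1) • s) = 0 := hl ⟨s, rfl⟩
  rwa [sub_smul, one_smul, map_sub, sub_eq_zero] at this

lemma functional_unip {S : Type*} [AddCommGroup S] [Module (Alg p) S]
    [Module (ZMod p) S] {l : S →ₗ[ZMod p] ZMod p}
    (hl : ∀ s, l (rightTr (unip (1 : ZMod p)) • s) = l s) (t : ZMod p) (s : S) :
    l (rightTr (unip t) • s) = l s := by
  rw [← ZMod.natCast_zmod_val t, ← unip_one_pow, map_pow]
  induction t.val with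
  | zero => simp
  | succ n ih => rw [pow_succ', mul_smul, hl, ih]

lemma geom_units (a : (ZMod p)ˣ) :
    ∑ r ∈ Finset.range (p - 1), (a : ZMod p) ^ (r + 1) = if a = 1 then -1 else 0 := by
  have hp := (Fact.out : p.Prime).one_lt
  split_ifs with h
  · subst h
    simp [Nat.cast_sub hp.le]
  · have h1 : (a : ZMod p) - 1 ≠ 0 := by
      rwa [sub_ne_zero, Ne, Units.val_eq_one]
    apply mul_right_cancel₀ h1
    simp only [pow_succ]
    rw [← Finset.sum_mul, mul_assoc, mul_comm (a : ZMod p), ← mul_assoc, geom_sum_mul,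
      ZMod.pow_card_sub_one_eq_one a.ne_zero]
    simp

lemma exists_homog_functional (S : Type*) [AddCommGroup S] [Module (Alg p) S]
    [Module (ZMod p) S] [IsScalarTower (ZMod p) (Alg p) S] [Nontrivial S] :
    ∃ r, 1 ≤ r ∧ r ≤ p - 1 ∧ ∃ l : S →ₗ[ZMod p] ZMod p, l ≠ 0 ∧
      (∀ (t : ZMod p) s, l (rightTr (unip t) • s) = l s) ∧
      ∀ (a : (ZMod p)ˣ) s, l (rightTr (torus a) • s) = (a : ZMod p)⁻¹ ^ r * l s := by
  obtain ⟨l, hl0, hl⟩ := exists_unip_invariant_functional (p := p) S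
  let L (r : ℕ) : S →ₗ[ZMod p] ZMod p := ∑ a : (ZMod p)ˣ,
    (a : ZMod p) ^ r • l ∘ₗ (Algebra.lsmul (ZMod p) (ZMod p) S (rightTr (torus a)))
  have hL : ∀ r s, L r s = ∑ a : (ZMod p)ˣ, (a : ZMod p) ^ r * l (rightTr (torus a) • s) := by
    intro r s
    simp only [L, LinearMap.sum_apply, LinearMap.smul_apply]
    rfl
  obtain ⟨s, hs⟩ : ∃ s, l s ≠ 0 := by
    by_contra! h
    exact hl0 (LinearMap.ext h)
  have hsum : ∑ r ∈ Finset.range (p - 1), L (r + 1) s = - l s := by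
    simp only [hL]
    rw [Finset.sum_comm]
    simp only [← Finset.sum_mul, geom_units]
    simp [torus_one]
  obtain ⟨r, hr, hr0⟩ := Finset.exists_ne_zero_of_sum_ne_zero
    (hsum.trans_ne (neg_ne_zero.2 hs))
  rw [Finset.mem_range] at hr
  refine ⟨r + 1, by omega, by omega, L (r + 1), fun h => hr0 (by rw [h]; rfl), ?_, ?_⟩
  · intro t s
    simp only [hL, smul_smul, ← map_mul, torus_mul_unip]
    simp only [map_mul, mul_smul, functional_unip hl]
  · intro a s
    simp only [hL, smul_smul, ← map_mul, torus_mul_torus, Finset.mul_sum]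
    refine Fintype.sum_bijective (fun b => b * a) (Group.mulRight_bijective a) _ _ fun b => ?_
    rw [← mul_assoc, Units.val_mul, ← mul_pow]
    congr 2
    field_simp [a.ne_zero]

/-- The map to functions given by matrix coefficients of a functional. -/
def coeffMap {S : Type*} [AddCommGroup S] [Module (Alg p) S]
    [Module (ZMod p) S] [IsScalarTower (ZMod p) (Alg p) S] (l : S →ₗ[ZMod p] ZMod p) :
    S →ₗ[Alg p] Fn p where
  toFun s g := l (rightTr g • s)
  map_add' s s' := by ext g; simp
  map_smul' a s := by
    obtain ⟨c, rfl⟩ := exists_eq_sum_rightTr a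
    ext g
    simp only [Finset.sum_smul, Finset.smul_sum, map_sum, Finset.sum_apply, RingHom.id_apply,
      smul_assoc, Pi.smul_apply, rightTr_smul_apply]
    refine Finset.sum_congr rfl fun x _ => ?_
    rw [map_mul, mul_smul, ← map_smul, ← algebraMap_smul (Alg p) (c x) (rightTr x • s),
      ← algebraMap_smul (Alg p) (c x) (rightTr g • _), smul_smul, smul_smul _ (rightTr g),
      Algebra.commutes]

lemma exists_embedding (S : Type*) [AddCommGroup S] [Module (Alg p) S]
    [Module (ZMod p) S] [IsScalarTower (ZMod p) (Alg p) S] [IsSimpleModule (Alg p) S] :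
    ∃ r ≤ p - 1, ∃ i : S →ₗ[Alg p] Fn p, Function.Injective i ∧ ∃ s, i s = lowPow r := by
  have := IsSimpleModule.nontrivial (Alg p) S
  obtain ⟨r, hr1, hr2, l, hl0, hlu, hlt⟩ := exists_homog_functional (p := p) S
  have happ : ∀ s g, coeffMap l s g = l (rightTr g • s) := fun s g => rfl
  have hinj : Function.Injective (coeffMap l) := by
    refine (LinearMap.injective_or_eq_zero (coeffMap l)).resolve_right fun h => hl0 ?_
    ext s
    have := congrFun (congrArg (fun f => f s) h) 1
    simpa [happ] using this
  have hN : LinearMap.range (coeffMap l) ≠ ⊥ := by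
    rw [Ne, LinearMap.range_eq_bot]
    intro h
    obtain ⟨s, hs⟩ := exists_ne (0 : S)
    exact hs (hinj (by rw [h]; rfl))
  obtain ⟨f, hfN, hf0, hfix⟩ := exists_unip_fixed hN
  have hfix' : ∀ g, f (g * unip 1) = f g := fun g => congrFun hfix g
  have hf : IsHomog r f := by
    obtain ⟨s, rfl⟩ := hfN
    refine ⟨fun t g => ?_, fun a g => ?_⟩
    · rw [happ, map_mul, mul_smul, hlu]; rfl
    · rw [happ, map_mul, mul_smul, hlt]; rfl
  suffices h : ∃ r ≤ p - 1, ∃ y ∈ LinearMap.range (coeffMap l), ∃ c : ZMod p, c ≠ 0 ∧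
      y = c • lowPow r by
    obtain ⟨r, hr, _, ⟨s, rfl⟩, c, hc, hy⟩ := h
    refine ⟨r, hr, coeffMap l, hinj, algebraMap (ZMod p) (Alg p) c⁻¹ • s, ?_⟩
    rw [map_smul, hy, algebraMap_smul, smul_smul, inv_mul_cancel₀ hc, one_smul]
  by_cases hc : f 1 * (-1) ^ r - (if r = p - 1 then f weyl else 0) = 0
  · by_cases hrp : r = p - 1
    · rw [if_pos hrp, hrp, ZMod.pow_card_sub_one_eq_one (by simp), mul_one, sub_eq_zero] at hc
      have hfc : f = f weyl • lowPow 0 := by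
        ext g
        rw [hf.apply_eq hfix' g, hc, hrp]
        simp only [lowPow, Pi.smul_apply, pow_zero, smul_eq_mul, mul_one]
        split_ifs with hg
        · have := g.det_coe
          rw [det_fin_two, hg, mul_zero, sub_zero] at this
          rw [ZMod.pow_card_sub_one_eq_one (right_ne_zero_of_mul_eq_one this), mul_one]
        · rw [ZMod.pow_card_sub_one_eq_one hg, mul_one]
      exact ⟨0, by omega, f, hfN, _, fun h => hf0 (by rw [hfc, h, zero_smul]), hfc⟩
    · rw [if_neg hrp, sub_zero] at hc
      have h1 : f 1 = 0 := by simpa using hc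
      have hfc : f = f weyl • lowPow r := by
        ext g
        rw [hf.apply_eq hfix' g, h1]
        simp only [lowPow, Pi.smul_apply, smul_eq_mul]
        split_ifs with hg
        · rw [hg, zero_pow (by omega)]; simp
        · rfl
      exact ⟨r, hr2, f, hfN, _, fun h => hf0 (by rw [hfc, h, zero_smul]), hfc⟩
  · refine ⟨r, hr2, ∑ t : ZMod p, rightTr (unip t * weyl) • f,
      Submodule.sum_mem _ fun t _ => Submodule.smul_mem _ _ hfN, _, hc, ?_⟩
    ext g
    rw [Finset.sum_apply, Pi.smul_apply, smul_eq_mul, ← sum_unip_weyl hr1 hr2 hf hfix']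
    rfl

/-- An element killing all the simple modules `lowMod r` is nilpotent. -/
lemma isNilpotent_of_forall_smul_eq_zero {x : Alg p}
    (hx : ∀ r ≤ p - 1, ∀ f ∈ lowMod (p := p) r, x • f = 0) : IsNilpotent x := by
  have : IsArtinianRing (Alg p) := IsArtinianRing.of_finite (ZMod p) (Alg p)
  have hmem : x ∈ Ring.jacobson (Alg p) := by
    rw [Ring.jacobson, Module.jacobson, Submodule.mem_sInf]
    intro m hm
    have : IsSimpleModule (Alg p) (Alg p ⧸ m) := isSimpleModule_iff_isCoatom.2 hm
    obtain ⟨r, hr, i, hi, s, hs⟩ := exists_embedding (p := p) (Alg p ⧸ m)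
    have hs0 : s ≠ 0 := by
      rintro rfl
      exact lowPow_ne_zero (p := p) r (by rw [← hs, map_zero])
    obtain ⟨a, ha⟩ := IsSimpleModule.toSpanSingleton_surjective (Alg p) hs0
      (Submodule.Quotient.mk (p := m) 1)
    have ha' : a • s = Submodule.Quotient.mk (p := m) 1 := ha
    have h1 : x • (Submodule.Quotient.mk (p := m) 1) = 0 := by
      apply hi
      rw [← ha', map_smul, map_smul, hs, map_zero]
      exact hx r hr _ (Submodule.smul_mem _ _ (lowPow_mem r))
    rw [← Submodule.Quotient.mk_smul, Submodule.Quotient.mk_eq_zero] at h1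
    simpa using h1
  obtain ⟨n, hn⟩ := IsSemiprimaryRing.isNilpotent (R := Alg p)
  refine ⟨n, ?_⟩
  have := Ideal.pow_mem_pow hmem n
  rw [hn] at this
  exact this

end

end SLTwo

namespace SLTwo
noncomputable section
open Matrix

variable {p : ℕ} [Fact p.Prime]

/-- Binary forms of degree `r` in the bottom row. -/
def formMap (r : ℕ) : (Fin (r + 1) → ZMod p) →ₗ[ZMod p] Fn p where
  toFun a g := ∑ i, a i * (g 1 0 ^ (r - i) * g 1 1 ^ (i : ℕ))
  map_add' a b := by ext g; simp [add_mul, Finset.sum_add_distrib]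
  map_smul' c a := by ext g; simp [mul_assoc, Finset.mul_sum]

lemma formMap_apply (r : ℕ) (a : Fin (r + 1) → ZMod p) (g) :
    formMap r a g = ∑ i, a i * (g 1 0 ^ (r - i) * g 1 1 ^ (i : ℕ)) := rfl

lemma formMap_injective {r : ℕ} (hr : r ≤ p - 1) : Function.Injective (formMap (p := p) r) := by
  rw [← LinearMap.ker_eq_bot, LinearMap.ker_eq_bot']
  intro a ha
  have hp := (Fact.out : p.Prime).one_lt
  let P : Polynomial (ZMod p) := ∑ i : Fin (r + 1), Polynomial.monomial (i : ℕ) (a i)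
  have hP : P = 0 := by
    apply Polynomial.eq_zero_of_natDegree_lt_card_of_eval_eq_zero P (f := id)
      Function.injective_id
    · intro d
      have := congrFun ha (weyl * unip d)
      have h1 : (weyl * unip d).1 1 0 = 1 := by simp [weyl_coe, unip_coe]
      have h2 : (weyl * unip d).1 1 1 = d := by simp [weyl_coe, unip_coe]
      rw [formMap_apply, h1, h2] at this
      simpa [P, Polynomial.eval_finsetSum] using this
    · rw [ZMod.card]
      refine lt_of_le_of_lt (Polynomial.natDegree_sum_le_of_forall_le (n := r) _ _ ?_) (by omega)
      intro i _
      exact (Polynomial.natDegree_monomial_le _).trans (Nat.lt_succ_iff.1 i.2)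
  ext i
  have := congrArg (fun Q => Polynomial.coeff Q (i : ℕ)) hP
  simpa [P, Polynomial.finsetSum_coeff, Polynomial.coeff_monomial, Fin.val_inj] using this

lemma rightTr_lowPow (r : ℕ) (x g : SpecialLinearGroup (Fin 2) (ZMod p)) :
    (rightTr x • lowPow r) g = (g 1 0 * x 0 0 + g 1 1 * x 1 0) ^ r := by
  change (g * x).1 1 0 ^ r = _
  congr 1
  simp [Matrix.mul_apply, Fin.sum_univ_two]

lemma range_formMap {r : ℕ} (hr : r ≤ p - 1) :
    LinearMap.range (formMap r) = (lowMod (p := p) r).restrictScalars (ZMod p) := by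
  have hp := (Fact.out : p.Prime).one_lt
  apply le_antisymm
  · suffices h : ∀ i : Fin (r + 1), formMap (p := p) r (Pi.single i 1) ∈ lowMod r by
      rintro _ ⟨a, rfl⟩
      rw [pi_eq_sum_univ' a, map_sum]
      refine Submodule.sum_mem _ fun i _ => ?_
      rw [map_smul]
      exact Submodule.smul_mem _ _ (h i)
    intro i
    have happ : ∀ g, formMap (p := p) r (Pi.single i 1) g = g 1 0 ^ (r - i) * g 1 1 ^ (i : ℕ) := by
      intro g
      simp [formMap_apply, Pi.single_apply]
    rcases Nat.eq_zero_or_pos (i : ℕ) with hi | hi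
    · have : formMap (p := p) r (Pi.single i 1) = lowPow r := by
        ext g
        rw [happ, hi]
        simp [lowPow]
      rw [this]
      exact lowPow_mem r
    · have hir := i.2
      let x (t : ZMod p) : SpecialLinearGroup (Fin 2) (ZMod p) :=
        ⟨!![1, 0; t, 1], by simp [det_fin_two_of]⟩
      have hx : ∀ t g, (rightTr (x t) • lowPow r) g = (g 1 0 + g 1 1 * t) ^ r := by
        intro t g
        rw [rightTr_lowPow]
        simp [x]
      have hchoose : (r.choose i : ZMod p) ≠ 0 := by
        rw [Ne, ZMod.natCast_eq_zero_iff]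
        intro h
        have h2 : p ∣ r.factorial := by
          rw [← Nat.choose_mul_factorial_mul_factorial (show (i : ℕ) ≤ r by omega), mul_assoc]
          exact h.mul_right _
        rw [(Fact.out : p.Prime).dvd_factorial] at h2
        omega
      have hsum : ∑ t : ZMod p, t ^ (p - 1 - i) • (rightTr (x t) • lowPow r) =
          (-(r.choose i : ZMod p)) • formMap (p := p) r (Pi.single i 1) := by
        ext g
        simp only [Finset.sum_apply, Pi.smul_apply, hx, smul_eq_mul, happ, add_pow, Finset.mul_sum]
        rw [Finset.sum_comm, Finset.sum_eq_single (r - i)]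
        · have e : ∀ t : ZMod p, t ^ (p - 1 - i) * (g 1 0 ^ (r - i : ℕ) * (g 1 1 * t) ^ (r - (r - i)) *
              (r.choose (r - i))) = (r.choose i * (g 1 0 ^ (r - i : ℕ) * g 1 1 ^ (i : ℕ))) * t ^ (p - 1) := by
            intro t
            rw [Nat.choose_symm (by omega), show r - (r - i : ℕ) = i by omega,
              show t ^ (p - 1) = t ^ (p - 1 - i) * t ^ (i : ℕ) by rw [← pow_add]; congr 1; omega]
            ring
          rw [Finset.sum_congr rfl fun t _ => e t, ← Finset.mul_sum,
            sum_pow_eq (by omega) le_rfl, if_pos rfl]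
          ring
        · intro j hj hne
          rw [Finset.mem_range] at hj
          have e : ∀ t : ZMod p, t ^ (p - 1 - i) * (g 1 0 ^ j * (g 1 1 * t) ^ (r - j) *
              (r.choose j)) = (r.choose j * (g 1 0 ^ j * g 1 1 ^ (r - j))) *
                t ^ (p - 1 - i + (r - j)) := by
            intro t
            rw [pow_add]
            ring
          rw [Finset.sum_congr rfl fun t _ => e t, ← Finset.mul_sum]
          have : ∑ t : ZMod p, t ^ (p - 1 - i + (r - j)) = 0 := by
            rcases Nat.lt_or_ge (p - 1 - i + (r - j)) (p - 1) with h | h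
            · exact FiniteField.sum_pow_lt_card_sub_one _ _ (by rwa [ZMod.card])
            · obtain ⟨m, hm⟩ : ∃ m, p - 1 - i + (r - j) = (p - 1) + m := ⟨_, (Nat.add_sub_cancel' h).symm⟩
              have hm1 : 1 ≤ m := by omega
              have e2 : ∀ t : ZMod p, t ^ (p - 1 - i + (r - j)) = t ^ m := by
                intro t
                rw [hm, pow_add]
                by_cases ht : t = 0
                · rw [ht, zero_pow (show m ≠ 0 by omega), mul_zero]
                · rw [ZMod.pow_card_sub_one_eq_one ht, one_mul]
              rw [Finset.sum_congr rfl fun t _ => e2 t]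
              exact FiniteField.sum_pow_lt_card_sub_one _ _ (by rw [ZMod.card]; omega)
          rw [this, mul_zero]
        · intro h
          exact absurd (Finset.mem_range.2 (by omega)) h
      have : formMap (p := p) r (Pi.single i 1) = (-(r.choose i : ZMod p))⁻¹ •
          ∑ t : ZMod p, t ^ (p - 1 - i) • (rightTr (x t) • lowPow r) := by
        rw [hsum, smul_smul, inv_mul_cancel₀ (neg_ne_zero.2 hchoose), one_smul]
      rw [this]
      refine Submodule.smul_of_tower_mem _ _ (Submodule.sum_mem _ fun t _ => ?_)
      exact Submodule.smul_of_tower_mem _ _ (Submodule.smul_mem _ _ (lowPow_mem r))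
  · intro f hf
    obtain ⟨a, rfl⟩ := Submodule.mem_span_singleton.1 hf
    obtain ⟨c, rfl⟩ := exists_eq_sum_rightTr a
    rw [Finset.sum_smul]
    refine Submodule.sum_mem _ fun x _ => ?_
    rw [smul_assoc]
    refine Submodule.smul_mem _ _ ⟨fun i => r.choose i * (x 0 0 ^ (r - i) * x 1 0 ^ (i : ℕ)), ?_⟩
    ext g
    rw [rightTr_lowPow, add_comm (g 1 0 * x 0 0), add_pow, formMap_apply, Finset.sum_range]
    refine Finset.sum_congr rfl fun i _ => ?_
    rw [mul_pow, mul_pow]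
    ring

lemma finrank_lowMod {r : ℕ} (hr : r ≤ p - 1) :
    Module.finrank (ZMod p) (lowMod (p := p) r) = r + 1 := by
  have h := LinearMap.finrank_range_of_inj (formMap_injective hr)
  rw [range_formMap hr] at h
  rw [Module.finrank_fintype_fun_eq_card, Fintype.card_fin] at h
  exact h

end

end SLTwo

namespace SLTwo
noncomputable section
open Matrix

variable {p : ℕ} [Fact p.Prime]

lemma exists_smul_of_lowMod_hom {r s : Fin p}
    (φ : lowMod (p := p) (s : ℕ) →ₗ[Alg p] lowMod (p := p) (r : ℕ)) :
    if _h : r = s then ∃ c : ZMod p, ∀ m, (φ m : Fn p) = c • (m : Fn p) else φ = 0 := by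
  have hs := s.2
  have hr := r.2
  let y : lowMod (p := p) (s : ℕ) := ⟨lowPow s, lowPow_mem _⟩
  have hy : ∀ t : ZMod p, rightTr (unip t) • y = y := fun t =>
    Subtype.ext (funext fun g => lowPow_mul_unip _ _ _)
  have h1 : rightTr (unip (1 : ZMod p)) • (φ y : Fn p) = φ y := by
    rw [← Submodule.coe_smul, ← map_smul, hy]
  have h2 := eq_smul_lowPow (by omega) (φ y).2 h1
  split_ifs with h
  · subst h
    refine ⟨(φ y : Fn p) weyl, fun m => ?_⟩
    obtain ⟨a, ha⟩ := Submodule.mem_span_singleton.1 m.2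
    obtain rfl : a • y = m := Subtype.ext ha
    rw [map_smul, Submodule.coe_smul, Submodule.coe_smul, smul_comm, ← h2]
  · have : IsSimpleModule (Alg p) (lowMod (p := p) (s : ℕ)) :=
      isSimpleModule_iff_isAtom.2 (lowMod_isAtom (by omega))
    have : IsSimpleModule (Alg p) (lowMod (p := p) (r : ℕ)) :=
      isSimpleModule_iff_isAtom.2 (lowMod_isAtom (by omega))
    refine (LinearMap.bijective_or_eq_zero φ).resolve_left fun hb => h ?_
    have e := (LinearEquiv.ofBijective φ hb).restrictScalars (ZMod p)
    have := e.finrank_eq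
    rw [finrank_lowMod (by omega), finrank_lowMod (by omega)] at this
    exact Fin.ext (by omega)

variable (p) in
/-- The sum of the simple modules `lowMod r` for `r < p`. -/
abbrev LowSum : Type := ∀ r : Fin p, lowMod (p := p) (r : ℕ)

variable (p) in
/-- The index set for a basis of `LowSum p`. -/
abbrev Idx : Type := Σ r : Fin p, Fin ((r : ℕ) + 1)

variable (p) in
/-- A basis adapted to the decomposition of `LowSum p`. -/
def lowBasis : Module.Basis (Idx p) (ZMod p) (LowSum p) :=
  Pi.basis fun r => Module.finBasisOfFinrankEq _ _
    (finrank_lowMod (p := p) (r := r) (by have := r.2; omega))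

lemma lowBasis_apply_of_ne {j : Idx p} {r : Fin p} (h : r ≠ j.1) : lowBasis p j r = 0 := by
  obtain ⟨s, i⟩ := j
  rw [lowBasis, Pi.basis_apply, Pi.single_eq_of_ne h]

lemma lowBasis_repr_smul {m m' : LowSum p} {j : Idx p} {c : ZMod p} (h : m j.1 = c • m' j.1) :
    (lowBasis p).repr m j = c * (lowBasis p).repr m' j := by
  rw [lowBasis, Pi.basis_repr, Pi.basis_repr, h, map_smul]
  rfl

lemma exists_end_lowSum (φ : Module.End (Alg p) (LowSum p)) :
    ∃ c : Fin p → ZMod p, ∀ m r, φ m r = c r • m r := by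
  let ψ (r s : Fin p) : lowMod (p := p) (s : ℕ) →ₗ[Alg p] lowMod (p := p) (r : ℕ) :=
    LinearMap.proj r ∘ₗ φ ∘ₗ LinearMap.single (Alg p) (fun r : Fin p => lowMod (p := p) (r : ℕ)) s
  have h1 : ∀ r, ∃ c : ZMod p, ∀ m, (ψ r r m : Fn p) = c • (m : Fn p) := fun r => by
    simpa using exists_smul_of_lowMod_hom (ψ r r)
  have h2 : ∀ r s, r ≠ s → ψ r s = 0 := fun r s h => by
    simpa [h] using exists_smul_of_lowMod_hom (ψ r s)
  choose c hc using h1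
  refine ⟨c, fun m r => ?_⟩
  have : φ m r = ∑ s, ψ r s (m s) := by
    conv_lhs => rw [← Finset.univ_sum_single m]
    rw [map_sum, Finset.sum_apply]
    rfl
  rw [this, Finset.sum_eq_single r]
  · exact Subtype.ext (hc r _)
  · intro s _ hs
    rw [h2 r s hs.symm]; rfl
  · simp

variable (p) in
/-- The action on the sum of the simple modules. -/
def act : Alg p →ₐ[ZMod p] Module.End (ZMod p) (LowSum p) :=
  Algebra.lsmul (ZMod p) (ZMod p) (LowSum p)

lemma act_apply (a : Alg p) (m : LowSum p) : act p a m = a • m := rfl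

/-- The rank one projections attached to the basis. -/
def rankOne (j : Idx p) : Module.End (ZMod p) (LowSum p) :=
  ((lowBasis p).coord j).smulRight (lowBasis p j)

lemma rankOne_apply (j : Idx p) (m : LowSum p) :
    rankOne j m = (lowBasis p).repr m j • lowBasis p j := rfl

lemma rankOne_completeOrthogonal : CompleteOrthogonalIdempotents (rankOne (p := p)) where
  idem j := by
    refine LinearMap.ext fun m => ?_
    simp [Module.End.mul_apply, rankOne_apply]
  ortho i j hij := by
    refine LinearMap.ext fun m => ?_
    simp [Module.End.mul_apply, rankOne_apply, hij.symm]
  complete := by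
    refine LinearMap.ext fun m => ?_
    rw [LinearMap.sum_apply]
    exact (lowBasis p).sum_repr m

lemma exists_act_eq_rankOne (j : Idx p) : ∃ a, act p a = rankOne j := by
  classical
  have hsimple : ∀ r : Fin p, IsSimpleModule (Alg p) (lowMod (p := p) (r : ℕ)) := fun r =>
    isSimpleModule_iff_isAtom.2 (lowMod_isAtom (by have := r.2; omega))
  let F : Module.End (Module.End (Alg p) (LowSum p)) (LowSum p) :=
    { toFun := rankOne j
      map_add' := map_add _
      map_smul' φ m := by
        obtain ⟨c, hc⟩ := exists_end_lowSum φ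
        have h1 : φ (lowBasis p j) = c j.1 • lowBasis p j := by
          ext1 r
          rw [hc]
          by_cases h : r = j.1
          · subst h; rfl
          · rw [Pi.smul_apply, lowBasis_apply_of_ne h, smul_zero, smul_zero]
        simp only [Module.End.smul_def, RingHom.id_apply, rankOne_apply]
        rw [lowBasis_repr_smul (hc m j.1)]
        rw [← algebraMap_smul (Alg p) ((lowBasis p).repr m j) (lowBasis p j), map_smul, h1,
          algebraMap_smul, smul_smul, mul_comm] }
  obtain ⟨a, ha⟩ := jacobson_density F (Finset.univ.image (lowBasis p))
  refine ⟨a, (lowBasis p).ext fun i => ?_⟩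
  exact (ha _ (Finset.mem_image_of_mem _ (Finset.mem_univ i))).symm

lemma isNilpotent_of_act_eq_zero {x : Alg p} (hx : act p x = 0) : IsNilpotent x := by
  apply isNilpotent_of_forall_smul_eq_zero
  intro r hr f hf
  have hp := (Fact.out : p.Prime).one_lt
  have h := congrFun (congrArg (fun φ => φ (Pi.single (⟨r, by omega⟩ : Fin p)
    (⟨f, hf⟩ : lowMod (p := p) r) : LowSum p)) hx) ⟨r, by omega⟩
  simpa [act_apply] using congrArg (fun v : lowMod (p := p) r => (v : Fn p)) h

lemma rightTr_neg_one_commute (a : Alg p) : Commute (rightTr (-1)) a := by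
  obtain ⟨c, rfl⟩ := exists_eq_sum_rightTr a
  refine Commute.sum_right _ _ _ fun x _ => Commute.smul_right ?_ _
  rw [Commute, SemiconjBy, ← map_mul, ← map_mul, neg_one_mul, mul_neg_one]

lemma rightTr_neg_one_smul {r : ℕ} {f : Fn p} (hf : f ∈ lowMod r) :
    rightTr (-1 : SpecialLinearGroup (Fin 2) (ZMod p)) • f = (-1 : ZMod p) ^ r • f := by
  obtain ⟨a, rfl⟩ := Submodule.mem_span_singleton.1 hf
  rw [smul_smul, (rightTr_neg_one_commute a).eq, mul_smul, ← smul_comm a]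
  congr 1
  refine funext fun g => ?_
  rw [rightTr_smul_apply, mul_neg_one, Pi.smul_apply, smul_eq_mul]
  simp [lowPow, neg_pow (g 1 0)]

lemma act_center (j : Idx p) :
    act p (rightTr (-1)) * rankOne j = (-1 : ZMod p) ^ (j.1 : ℕ) • rankOne j := by
  refine LinearMap.ext fun m => ?_
  rw [Module.End.mul_apply, rankOne_apply, map_smul, LinearMap.smul_apply, rankOne_apply,
    smul_comm, act_apply]
  congr 1
  ext1 r
  by_cases h : r = j.1
  · subst h
    exact Subtype.ext (rightTr_neg_one_smul (lowBasis p j j.1).2)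
  · rw [Pi.smul_apply, Pi.smul_apply, lowBasis_apply_of_ne h, smul_zero, smul_zero]

lemma exists_lift_idempotents {I k R M : Type*} [Fintype I] [Field k] [Ring R] [Algebra k R]
    [AddCommGroup M] [Module k M] (f : R →ₐ[k] Module.End k M)
    (hf : ∀ x, f x = 0 → IsNilpotent x) {E : I → Module.End k M}
    (hE : CompleteOrthogonalIdempotents E) (hE' : ∀ i, ∃ x, f x = E i) :
    ∃ e : I → R, CompleteOrthogonalIdempotents e ∧ ∀ i, f (e i) = E i := by
  obtain ⟨e, he, he'⟩ := CompleteOrthogonalIdempotents.lift_of_isNilpotent_ker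
    (f := (f : R →+* Module.End k M))
    (fun x hx => hf x (RingHom.mem_ker.1 hx)) hE hE'
  exact ⟨e, he, congrFun he'⟩

variable (p) in
lemma exists_idempotents : ∃ e : Idx p → Alg p, CompleteOrthogonalIdempotents e ∧
    ∀ j, act p (e j) = rankOne j :=
  exists_lift_idempotents (act p)
    (fun _ hx => isNilpotent_of_act_eq_zero hx) rankOne_completeOrthogonal exists_act_eq_rankOne

/-- The coefficient of an algebra element at a basis vector. -/
def diagCoeff (j : Idx p) : Alg p →ₗ[ZMod p] ZMod p :=
  (lowBasis p).coord j ∘ₗ LinearMap.applyₗ (lowBasis p j) ∘ₗ (act p).toLinearMap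

lemma diagCoeff_apply (j : Idx p) (a : Alg p) :
    diagCoeff j a = (lowBasis p).repr (act p a (lowBasis p j)) j := rfl

lemma diagCoeff_self {e : Alg p} {j : Idx p} (he : act p e = rankOne j) : diagCoeff j e = 1 := by
  rw [diagCoeff_apply, he]; simp [rankOne_apply]

lemma exists_corner_inverse {e : Alg p} {j : Idx p} (hee : e * e = e) (he : act p e = rankOne j)
    {h : Alg p} (hh : e * h * e = h) (hκ : diagCoeff j h ≠ 0) :
    ∃ h', e * h' * e = h' ∧ h * h' = e ∧ h' * h = e := by
  set c := diagCoeff j h with hc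
  have hact : act p h = c • act p e := by
    rw [he]
    refine LinearMap.ext fun m => ?_
    rw [← hh, map_mul, map_mul, he, hc, diagCoeff_apply]
    simp only [Module.End.mul_apply, LinearMap.smul_apply, rankOne_apply, map_smul,
      smul_smul]
    rw [mul_comm]
  set n := c⁻¹ • h - e with hn
  have hnil : IsNilpotent n := by
    apply isNilpotent_of_act_eq_zero
    rw [hn, map_sub, map_smul, hact, smul_smul, inv_mul_cancel₀ hκ, one_smul, sub_self]
  have heh : e * h = h := by rw [← hh]; simp only [← mul_assoc, hee]
  have hhe : h * e = h := by rw [← hh]; simp only [mul_assoc, hee]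
  have hcomm : Commute e n := by
    simp [Commute, SemiconjBy, hn, mul_sub, sub_mul, heh, hhe]
  obtain ⟨u, hu⟩ := hnil.isUnit_one_add
  have hcu : Commute e (u : Alg p) := by rw [hu]; exact (Commute.one_right e).add_right hcomm
  have hcu' : Commute e ((u⁻¹ : (Alg p)ˣ) : Alg p) := hcu.units_inv_right
  have hhu : h = c • (u * e) := by
    rw [hu, add_mul, one_mul, hn, sub_mul, smul_mul_assoc, hhe, hee, add_sub_cancel, smul_smul,
      mul_inv_cancel₀ hκ, one_smul]
  refine ⟨c⁻¹ • (u⁻¹ * e), ?_, ?_, ?_⟩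
  · rw [mul_smul_comm, smul_mul_assoc, ← mul_assoc, hcu'.eq, mul_assoc, mul_assoc, hee, hee]
  · rw [hhu, smul_mul_smul_comm, mul_inv_cancel₀ hκ, one_smul, mul_assoc, ← mul_assoc e, hcu'.eq,
      mul_assoc, hee, ← mul_assoc, Units.mul_inv, one_mul]
  · rw [hhu, smul_mul_smul_comm, inv_mul_cancel₀ hκ, one_smul, mul_assoc, ← mul_assoc e, hcu.eq,
      mul_assoc, hee, ← mul_assoc, Units.inv_mul, one_mul]

lemma two_ne_zero_zmod (hp : 2 < p) : (2 : ZMod p) ≠ 0 := by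
  intro h
  have : ((2 : ℕ) : ZMod p) = 0 := by exact_mod_cast h
  rw [ZMod.natCast_eq_zero_iff] at this
  exact absurd (Nat.le_of_dvd (by norm_num) this) (by omega)

/-- The projection to the functions of a given parity. -/
def parity (ε : ZMod p) : Alg p := (2 : ZMod p)⁻¹ • (1 + ε • rightTr (-1))

lemma parity_add_parity_neg (hp : 2 < p) (ε : ZMod p) : parity ε + parity (-ε) = 1 := by
  have h2 : (2 : ZMod p) ≠ 0 := two_ne_zero_zmod hp
  rw [parity, parity, ← smul_add, neg_smul, add_add_add_comm, add_neg_cancel, add_zero,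
    ← two_smul (ZMod p) (1 : Alg p), smul_smul, inv_mul_cancel₀ h2, one_smul]

lemma parity_commute (ε : ZMod p) (a : Alg p) : Commute (parity ε) a :=
  ((Commute.one_left a).add_left ((rightTr_neg_one_commute a).smul_left ε)).smul_left _

lemma parity_mul_parity (hp : 2 < p) {ε : ZMod p} (hε : ε * ε = 1) :
    parity ε * parity ε = parity ε := by
  have h2 : (2 : ZMod p) ≠ 0 := two_ne_zero_zmod hp
  have hz : rightTr (-1) * rightTr (-1) = (1 : Alg p) := by
    rw [← map_mul, neg_mul_neg, one_mul, map_one]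
  have : (1 + ε • rightTr (-1)) * (1 + ε • rightTr (-1)) =
      (2 : ZMod p) • (1 + ε • rightTr (-1) : Alg p) := by
    rw [add_mul, one_mul, mul_add, mul_one, smul_mul_smul_comm, hz, hε, one_smul, two_smul]
    abel
  rw [parity, smul_mul_smul_comm, this, smul_smul, mul_assoc, inv_mul_cancel₀ h2, mul_one]

lemma parity_mul_eq (hp : 2 < p) {e : Alg p} {j : Idx p} (hee : e * e = e)
    (he : act p e = rankOne j) :
    parity ((-1) ^ (j.1 : ℕ)) * e = e ∧ parity (-(-1) ^ (j.1 : ℕ)) * e = 0 := by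
  set ε : ZMod p := (-1) ^ (j.1 : ℕ) with hε
  have hεε : ε * ε = 1 := by rw [hε, ← mul_pow, neg_mul_neg, one_mul, one_pow]
  have h0 : parity (-ε) * e = 0 := by
    have hi : parity (-ε) * e * (parity (-ε) * e) = parity (-ε) * e := by
      rw [(parity_commute (-ε) e).eq, mul_assoc, ← mul_assoc _ e, (parity_commute (-ε) e).eq,
        mul_assoc, parity_mul_parity hp (by simpa using hεε), ← mul_assoc, hee]
    have hn : IsNilpotent (parity (-ε) * e) := by
      apply isNilpotent_of_act_eq_zero
      rw [map_mul, he, parity, map_smul, map_add, map_one, map_smul, smul_mul_assoc, add_mul,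
        one_mul, smul_mul_assoc, act_center, ← hε, smul_smul, neg_mul, hεε]
      have : rankOne j + (-1 : ZMod p) • rankOne j = 0 := by module
      exact (congrArg _ this).trans (smul_zero _)
    exact hn.eq_zero_of_isIdempotentElem hi
  refine ⟨?_, h0⟩
  have := parity_add_parity_neg hp ε
  calc parity ε * e = (parity ε + parity (-ε)) * e := by rw [add_mul, h0, add_zero]
    _ = e := by rw [this, one_mul]

end

end SLTwo

namespace SLTwo

section Matching
variable {C : Type*} [Category* C] [Preadditive C] [HasKernels C] [HasBinaryBiproducts C]

lemma isIso_of_isIso_comp_of_indecomposable {P W : C} (f : P ⟶ W) (g : W ⟶ P) [IsIso (f ≫ g)]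
    (hW : Indecomposable W) (hP : ¬ IsZero P) : IsIso f := by
  let g' := g ≫ inv (f ≫ g)
  have hfg : f ≫ g' = 𝟙 P := by simp only [g', ← Category.assoc]; exact IsIso.hom_inv_id _
  have hker : (𝟙 W - g' ≫ f) ≫ g' = 0 := by simp [Preadditive.sub_comp, hfg]
  have hι : kernel.ι g' ≫ g' = 0 := kernel.condition g'
  let e : W ≅ P ⊞ kernel g' :=
    { hom := biprod.lift g' (kernel.lift g' (𝟙 W - g' ≫ f) hker)
      inv := biprod.desc f (kernel.ι g')
      hom_inv_id := by simp
      inv_hom_id := by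
        ext <;> simp [hfg, Preadditive.comp_sub, reassoc_of% hfg, reassoc_of% hι] }
  have hz := ((hW.2 _ _ e).resolve_left hP).eq_of_tgt (kernel.lift g' (𝟙 W - g' ≫ f) hker) 0
  have h0 : 𝟙 W - g' ≫ f = 0 := by
    rw [← kernel.lift_ι g' (𝟙 W - g' ≫ f) hker, hz, zero_comp]
  exact ⟨g', hfg, (sub_eq_zero.1 h0).symm⟩

lemma matching {k : Type*} [AddCommGroup k] {α β : Type*} (P : α → C) (W : β → C)
    (hW : ∀ t, Indecomposable (W t))
    (hκ : ∀ j, ∃ κ : (P j ⟶ P j) →+ k, κ (𝟙 _) ≠ 0 ∧ ∀ h, κ h ≠ 0 → IsIso h)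
    (d : C → ℕ) (hd : ∀ X Y : C, (X ≅ Y) → d X = d Y) (hd1 : ∀ t, 1 ≤ d (W t))
    (J : Finset α) (T : Finset β) (X : ∀ j t, P j ⟶ W t) (Y : ∀ t j, W t ⟶ P j)
    (h1 : ∀ j ∈ J, ∑ t ∈ T, X j t ≫ Y t j = 𝟙 _)
    (h2 : ∀ j ∈ J, ∀ i ∈ J, j ≠ i → ∑ t ∈ T, X j t ≫ Y t i = 0) :
    J.card ≤ T.card ∧ T.card + ∑ j ∈ J, d (P j) ≤ J.card + ∑ t ∈ T, d (W t) := by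
  classical
  induction J using Finset.induction_on generalizing T X Y with
  | empty =>
    simp only [Finset.card_empty, Finset.sum_empty, zero_add, add_zero, zero_le, true_and]
    rw [Finset.card_eq_sum_ones]
    exact Finset.sum_le_sum fun t _ => hd1 t
  | insert j0 J hj0 ih =>
    obtain ⟨κ, hκ1, hκiso⟩ := hκ j0
    have hP : ¬ IsZero (P j0) := fun hz => hκ1 (by rw [hz.eq_of_src (𝟙 _) 0, map_zero])
    have hs := h1 j0 (Finset.mem_insert_self _ _)
    obtain ⟨t0, ht0, hne⟩ : ∃ t ∈ T, κ (X j0 t ≫ Y t j0) ≠ 0 := by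
      by_contra! hcon
      apply hκ1
      rw [← hs, map_sum]
      exact Finset.sum_eq_zero hcon
    have := hκiso _ hne
    have := isIso_of_isIso_comp_of_indecomposable (X j0 t0) (Y t0 j0) (hW t0) hP
    let X' (j t) := X j t - X j t0 ≫ inv (X j0 t0) ≫ X j0 t
    have hX' : ∀ j i, j0 ≠ i → i ∈ J → ∑ t ∈ T.erase t0, X' j t ≫ Y t i = ∑ t ∈ T, X j t ≫ Y t i := by
      intro j i hi hiJ
      have h3 := h2 j0 (Finset.mem_insert_self _ _) i (Finset.mem_insert_of_mem hiJ) hi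
      rw [← Finset.add_sum_erase _ _ ht0] at h3 ⊢
      simp only [X', Preadditive.sub_comp, Finset.sum_sub_distrib, Category.assoc]
      rw [← Preadditive.comp_sum, ← Preadditive.comp_sum, eq_neg_of_add_eq_zero_right h3]
      simp [add_comm]
    obtain ⟨ih1, ih2⟩ := ih (T.erase t0) X' Y
      (fun j hj => by
        rw [hX' j j (fun h => hj0 (h ▸ hj)) hj]
        exact h1 j (Finset.mem_insert_of_mem hj))
      (fun j hj i hi hij => by
        rw [hX' j i (fun h => hj0 (h ▸ hi)) hi]
        exact h2 j (Finset.mem_insert_of_mem hj) i (Finset.mem_insert_of_mem hi) hij)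
    have hc := Finset.card_erase_add_one ht0
    have hdd := hd _ _ (asIso (X j0 t0))
    rw [Finset.card_insert_of_notMem hj0, Finset.sum_insert hj0, ← Finset.add_sum_erase _ _ ht0]
    omega

end Matching

end SLTwo

namespace SLTwo
noncomputable section

section Systems

open scoped TensorProduct Classical

variable {k G : Type} [Field k] [Group G] (z : G)
  {M N : Type} [AddCommGroup M] [Module k M] [AddCommGroup N] [Module k N]

/-- The function supported on `{1, z}` with values `1` and `ε`. -/
def twoPoint (ε : k) (g : G) : k := if g = 1 then 1 else if g = z then ε else 0

/-- A representation has a system of size `x` and parity `ε` if it has `x` vectors and `x`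
functionals whose matrix coefficients are supported on `{1, z}` and orthonormal. -/
def HasSystem (ρ : Representation k G M) (ε : k) (x : ℕ) : Prop :=
  ∃ (v : Fin x → M) (f : Fin x → Module.Dual k M), ∀ i j g,
    f i (ρ g (v j)) = if i = j then twoPoint z ε g else 0

variable {z}

lemma HasSystem.of_fintype {ρ : Representation k G M} {ε : k} {ι : Type*} [Fintype ι]
    (v : ι → M) (f : ι → Module.Dual k M)
    (h : ∀ i j g, f i (ρ g (v j)) = if i = j then twoPoint z ε g else 0) {x : ℕ}
    (hx : Fintype.card ι = x) : HasSystem z ρ ε x := by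
  let e := Fintype.equivFinOfCardEq hx
  exact ⟨v ∘ e.symm, f ∘ e.symm, fun i j g => by simp [h]⟩

lemma HasSystem.of_equiv {ρ : Representation k G M} {σ : Representation k G N} {ε : k} {x : ℕ}
    (h : HasSystem z ρ ε x) (e : M ≃ₗ[k] N) (he : ∀ g m, σ g (e m) = e (ρ g m)) :
    HasSystem z σ ε x := by
  obtain ⟨v, f, h⟩ := h
  exact ⟨fun i => e (v i), fun i => f i ∘ₗ e.symm.toLinearMap, fun i j g => by simp [he, h]⟩

lemma twoPoint_mul_coord {σ : Representation k G N} {ε δ : k} (hσ : ∀ n, σ z n = δ • n)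
    {ι : Type} [DecidableEq ι] (b : Module.Basis ι k N) (i j : ι) (g : G) :
    twoPoint z ε g * b.coord i (σ g (b j)) = if i = j then twoPoint z (ε * δ) g else 0 := by
  have hb : b.coord i (b j) = if i = j then 1 else 0 := by
    simp [Finsupp.single_apply, eq_comm]
  unfold twoPoint
  by_cases h1 : g = 1
  · rw [h1, map_one, Module.End.one_apply, hb]
    simp
  by_cases h2 : g = z
  · rw [if_neg h1, if_neg h1, if_pos h2, if_pos h2, h2, hσ, map_smul, hb]
    simp
  · simp [h1, h2]

lemma HasSystem.tprod {ρ : Representation k G M} {σ : Representation k G N} {ε δ : k} {x : ℕ}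
    [Module.Finite k N] (h : HasSystem z ρ ε x) (hσ : ∀ n, σ z n = δ • n) :
    HasSystem z (ρ.tprod σ) (ε * δ) (x * Module.finrank k N) := by
  obtain ⟨v, f, h⟩ := h
  let b := Module.finBasis k N
  refine HasSystem.of_fintype (ι := Fin x × Fin (Module.finrank k N))
    (fun i => v i.1 ⊗ₜ[k] b i.2)
    (fun i => TensorProduct.dualDistrib k M N (f i.1 ⊗ₜ b.coord i.2)) ?_ (by simp)
  rintro ⟨i, l⟩ ⟨j, l'⟩ g
  rw [Representation.tprod_apply, TensorProduct.map_tmul, TensorProduct.dualDistrib_apply, h]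
  simp only [Prod.mk.injEq]
  by_cases hij : i = j
  · simp only [hij, true_and, if_true]
    exact twoPoint_mul_coord hσ b l l' g
  · simp [hij]

/-- The averaging projection attached to a system. -/
lemma exists_projection [Fintype G] (h2 : (2 : k) ≠ 0) (hz : z ≠ 1) (hz2 : z * z = 1)
    {ρ : Representation k G M} {x : ℕ} (hρ : ρ z = 1)
    {v : Fin x → M} {f : Fin x → Module.Dual k M}
    (h : ∀ i j g, f i (ρ g (v j)) = if i = j then twoPoint z 1 g else 0) :
    ∃ π : M →ₗ[k] M, (∀ g m, π (ρ g m) = ρ g (π m)) ∧ (∀ g i, π (ρ g (v i)) = ρ g (v i)) ∧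
      (∀ i m, f i (π m) = f i m) ∧
      LinearMap.range π ≤ Submodule.span k (Set.range fun q : Fin x × G => ρ q.2 (v q.1)) := by
  let π : M →ₗ[k] M := (2 : k)⁻¹ • ∑ i, ∑ g, (f i ∘ₗ ρ g⁻¹).smulRight (ρ g (v i))
  have hπ : ∀ m, π m = (2 : k)⁻¹ • ∑ i, ∑ g, f i (ρ g⁻¹ m) • ρ g (v i) := fun m => by
    simp [π]
  have hcomm : ∀ g m, π (ρ g m) = ρ g (π m) := by
    intro g m
    rw [hπ, hπ, map_smul, map_sum]
    congr 1
    refine Finset.sum_congr rfl fun i _ => ?_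
    rw [map_sum]
    refine Fintype.sum_bijective (g⁻¹ * ·) (Group.mulLeft_bijective _) _ _ fun a => ?_
    rw [map_smul, ← Module.End.mul_apply, ← Module.End.mul_apply, ← map_mul, ← map_mul]
    simp
  have hzz : z⁻¹ = z := inv_eq_of_mul_eq_one_left hz2
  have hsum : ∀ φ : G → k, ∑ g, φ g * twoPoint z 1 g = φ 1 + φ z := by
    intro φ
    have e : ∀ g, φ g * twoPoint z 1 g = (if g = 1 then φ 1 else 0) + if g = z then φ z else 0 := by
      intro g
      unfold twoPoint
      by_cases h1 : g = 1
      · subst h1; simp [hz.symm]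
      · by_cases h2 : g = z
        · subst h2; simp [h1]
        · simp [h1, h2]
    rw [Finset.sum_congr rfl fun g _ => e g, Finset.sum_add_distrib]
    simp
  have hsum' : ∀ φ : G → M, ∑ g, twoPoint z (1 : k) g⁻¹ • φ g = φ 1 + φ z := by
    intro φ
    have e : ∀ g, twoPoint z (1 : k) g⁻¹ • φ g =
        (if g = 1 then φ 1 else 0) + if g = z then φ z else 0 := by
      intro g
      unfold twoPoint
      by_cases h1 : g = 1
      · subst h1; simp [hz.symm]
      · by_cases h2 : g = z
        · subst h2; simp [h1, hzz]
        · simp [h1, h2, inv_eq_iff_eq_inv, hzz]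
    rw [Finset.sum_congr rfl fun g _ => e g, Finset.sum_add_distrib]
    simp
  have hhalf : ∀ m : M, (2 : k)⁻¹ • (m + m) = m := fun m => by
    rw [← two_smul k m, smul_smul, inv_mul_cancel₀ h2, one_smul]
  have hfix : ∀ i, π (v i) = v i := by
    intro i
    rw [hπ, Finset.sum_eq_single i]
    · simp only [h, if_true]
      rw [hsum' fun g => ρ g (v i), hρ, map_one, Module.End.one_apply, hhalf]
    · intro j _ hj
      simp [h, hj]
    · simp
  refine ⟨π, hcomm, fun g i => by rw [hcomm, hfix], ?_, ?_⟩
  · intro i m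
    rw [hπ, map_smul, map_sum, Finset.sum_eq_single i]
    · simp only [map_sum, map_smul, h, if_true, smul_eq_mul]
      rw [hsum fun g => f i (ρ g⁻¹ m), hzz, hρ, inv_one, map_one, Module.End.one_apply]
      rw [← two_mul, ← mul_assoc, inv_mul_cancel₀ h2, one_mul]
    · intro j _ hj
      simp [h, hj.symm]
    · simp
  · rintro _ ⟨m, rfl⟩
    rw [hπ]
    refine Submodule.smul_mem _ _ (Submodule.sum_mem _ fun i _ => Submodule.sum_mem _ fun g _ =>
      Submodule.smul_mem _ _ (Submodule.subset_span ⟨(i, g), rfl⟩))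

lemma two_mul_finrank_span_le [Fintype G] (hz : z ≠ 1) {ρ : Representation k G M} {x : ℕ}
    (hρ : ρ z = 1) (v : Fin x → M) :
    2 * Module.finrank k (Submodule.span k (Set.range fun q : Fin x × G => ρ q.2 (v q.1))) ≤
      x * Fintype.card G := by
  let F : Fin x × G → M := fun q => ρ q.2 (v q.1)
  have h1 : Module.finrank k (Submodule.span k (Set.range F)) ≤ (Finset.univ.image F).card := by
    have := finrank_span_finset_le_card (R := k) (Finset.univ.image F)
    rwa [Finset.coe_image, Finset.coe_univ, Set.image_univ] at this
  have h2 : 2 * (Finset.univ.image F).card ≤ (Finset.univ : Finset (Fin x × G)).card := by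
    refine Finset.mul_card_image_le_card _ _ fun m hm => ?_
    obtain ⟨⟨i, g⟩, -, rfl⟩ := Finset.mem_image.1 hm
    have : ({(i, g), (i, g * z)} : Finset (Fin x × G)) ⊆
        Finset.univ.filter fun q => F q = F (i, g) := by
      intro q hq
      rw [Finset.mem_insert, Finset.mem_singleton] at hq
      rw [Finset.mem_filter]
      rcases hq with rfl | rfl
      · simp
      · simp [F, hρ]
    refine le_trans ?_ (Finset.card_le_card this)
    rw [Finset.card_pair (by simp [hz])]
  simp only [Finset.card_univ, Fintype.card_prod, Fintype.card_fin] at h2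
  exact (Nat.mul_le_mul_left 2 h1).trans h2

lemma HasSystem.step [Fintype G] [Module.Finite k M] [Module.Finite k N] (h2 : (2 : k) ≠ 0)
    (hz : z ≠ 1) (hz2 : z * z = 1)
    {ρ : Representation k G M} {σ : Representation k G N} {x : ℕ} (hρ : ρ z = 1) (hσ : σ z = 1)
    (h : HasSystem z ρ 1 x) (h' : HasSystem z σ 1 1) {d D : ℕ} (hD : 2 * D = Fintype.card G)
    (hd : x * D + d = Module.finrank k M) :
    HasSystem z (ρ.tprod σ) 1 (x * Module.finrank k N + d) := by
  obtain ⟨v, f, h⟩ := h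
  obtain ⟨w, l, hwl⟩ := h'
  replace hwl : ∀ g, l 0 (σ g (w 0)) = twoPoint z 1 g := fun g => by rw [hwl, if_pos rfl]
  obtain ⟨π, hcomm, hfix, hf, hrange⟩ := exists_projection h2 hz hz2 hρ h
  have hππ : ∀ m, π (π m) = π m := by
    intro m
    have : Submodule.span k (Set.range fun q : Fin x × G => ρ q.2 (v q.1)) ≤
        LinearMap.eqLocus π LinearMap.id := by
      rw [Submodule.span_le]
      rintro _ ⟨⟨i, g⟩, rfl⟩
      exact hfix g i
    exact this (hrange ⟨m, rfl⟩)
  have hdk : d ≤ Module.finrank k (LinearMap.ker π) := by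
    have e1 := LinearMap.finrank_range_add_finrank_ker π
    have e2 := Submodule.finrank_mono hrange
    have e3 := two_mul_finrank_span_le hz hρ v
    have e4 : x * Fintype.card G = 2 * (x * D) := by rw [← hD]; ring
    omega
  let B := Module.finBasis k (LinearMap.ker π)
  let b : Fin d → M := fun i => B (Fin.castLE hdk i)
  let P : M →ₗ[k] LinearMap.ker π := (LinearMap.id - π).codRestrict _ fun m => by simp [hππ]
  have hPker : ∀ m (hm : m ∈ LinearMap.ker π), P m = ⟨m, hm⟩ := fun m hm => by
    apply Subtype.ext
    have : π m = 0 := hm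
    simp [P, this]
  have hPfix : ∀ m, π m = m → P m = 0 := fun m hm => Subtype.ext (by simp [P, hm])
  let β : Fin d → Module.Dual k M := fun i => B.coord (Fin.castLE hdk i) ∘ₗ P
  have hβb : ∀ i j, β i (b j) = if i = j then 1 else 0 := by
    intro i j
    simp only [β, b, LinearMap.comp_apply, hPker _ (B _).2]
    simp [Finsupp.single_apply, eq_comm]
  have hβv : ∀ i g j, β i (ρ g (v j)) = 0 := by
    intro i g j
    simp only [β, LinearMap.comp_apply, hPfix _ (hfix g j), map_zero]
  have hfb : ∀ i g j, f i (ρ g (b j)) = 0 := by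
    intro i g j
    have : π (b j) = 0 := (B (Fin.castLE hdk j)).2
    rw [← hf, hcomm, this, map_zero, map_zero]
  let c := Module.finBasis k N
  refine HasSystem.of_fintype (ι := Fin x × Fin (Module.finrank k N) ⊕ Fin d)
    (Sum.elim (fun i => v i.1 ⊗ₜ[k] c i.2) fun j => b j ⊗ₜ[k] w 0)
    (Sum.elim (fun i => TensorProduct.dualDistrib k M N (f i.1 ⊗ₜ c.coord i.2))
      fun j => TensorProduct.dualDistrib k M N (β j ⊗ₜ l 0)) ?_ (by simp)
  rintro (⟨i, q⟩ | i) (⟨j, q'⟩ | j) g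
  · simp only [Sum.elim_inl, Representation.tprod_apply, TensorProduct.map_tmul,
      TensorProduct.dualDistrib_apply, h, Sum.inl.injEq, Prod.mk.injEq]
    by_cases hij : i = j
    · simp only [hij, true_and, if_true]
      have := twoPoint_mul_coord (ε := 1) (δ := 1) (z := z) (σ := σ) (by simp [hσ]) c q q' g
      rw [this, mul_one]
    · simp [hij]
  · simp [hfb]
  · simp [hβv]
  · simp only [Sum.elim_inr, Representation.tprod_apply, TensorProduct.map_tmul,
      TensorProduct.dualDistrib_apply, hwl, Sum.inr.injEq]
    unfold twoPoint
    by_cases h1 : g = 1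
    · rw [h1, map_one, Module.End.one_apply, hβb]
      simp
    by_cases h2 : g = z
    · rw [h2, hρ, Module.End.one_apply, hβb]
      simp
    · simp [h1, h2]

end Systems
end
end SLTwo

namespace SLTwo
noncomputable section
section TensorPowers

variable {k G : Type} [Field k] [Group G] {z : G}

lemma nonempty_tpow_add_iso (V : FDRep k G) (n m : ℕ) :
    Nonempty (tpow V (n + m) ≅ tpow V n ⊗ tpow V m) := by
  induction m with
  | zero => exact ⟨(ρ_ _).symm⟩
  | succ m ih =>
    obtain ⟨e⟩ := ih
    exact ⟨whiskerRightIso e V ≪≫ α_ _ _ _⟩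

lemma finrank_tpow (V : FDRep k G) (n : ℕ) :
    Module.finrank k (tpow V n) = Module.finrank k V ^ n := by
  induction n with
  | zero => exact Module.finrank_self k
  | succ n ih =>
    rw [pow_succ, ← ih]
    exact Module.finrank_tensorProduct

lemma tpow_apply_of_apply_eq_neg (V : FDRep k G) (hV : ∀ v, V.ρ z v = -v) (n : ℕ)
    (m : tpow V n) : (tpow V n).ρ z m = (-1 : k) ^ n • m := by
  induction n with
  | zero => rw [pow_zero, one_smul]; rfl
  | succ n ih =>
    let A := tpow V n
    have : TensorProduct.map (A.ρ z) (V.ρ z) = (-1 : k) ^ (n + 1) • LinearMap.id := by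
      refine TensorProduct.ext' fun a v => ?_
      rw [TensorProduct.map_tmul, hV, ih, ← neg_one_smul k v, TensorProduct.smul_tmul_smul,
        ← pow_succ]
      rfl
    exact LinearMap.congr_fun this m

lemma exists_coeff_tpow (V : FDRep k G)
    (hV : ∀ g : G, g ≠ 1 → g ≠ z → ∃ (v : V) (f : Module.Dual k V), f v = 1 ∧ f (V.ρ g v) = 0)
    (S : Finset G) (hS : ∀ g ∈ S, g ≠ 1 ∧ g ≠ z) {n : ℕ} (hn : S.card = n) :
    ∃ (v : tpow V n) (f : Module.Dual k (tpow V n)), f v = 1 ∧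
      ∀ g ∈ S, f ((tpow V n).ρ g v) = 0 := by
  classical
  subst hn
  induction S using Finset.induction_on with
  | empty => exact ⟨(1 : k), (LinearMap.id : k →ₗ[k] k), rfl, by simp⟩
  | insert g S hg ih =>
    obtain ⟨v, f, h1, h0⟩ := ih fun g hg => hS g (Finset.mem_insert_of_mem hg)
    obtain ⟨w, l, h1', h0'⟩ := hV g (hS g (Finset.mem_insert_self _ _)).1
      (hS g (Finset.mem_insert_self _ _)).2
    rw [Finset.card_insert_of_notMem hg]
    let A := tpow V S.card
    refine ⟨(v ⊗ₜ[k] w : TensorProduct k A V),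
      (TensorProduct.dualDistrib k A V (f ⊗ₜ l) : Module.Dual k (TensorProduct k A V)), ?_, ?_⟩
    · change (TensorProduct.dualDistrib k A V (f ⊗ₜ l)) (v ⊗ₜ w) = 1
      rw [TensorProduct.dualDistrib_apply, h1, h1', one_mul]
    · intro g' hg'
      change (TensorProduct.dualDistrib k A V (f ⊗ₜ l))
        (TensorProduct.map (A.ρ g') (V.ρ g') (v ⊗ₜ w)) = 0
      rw [TensorProduct.map_tmul, TensorProduct.dualDistrib_apply]
      rcases Finset.mem_insert.1 hg' with rfl | hg'
      · rw [h0', mul_zero]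
      · rw [h0 g' hg', zero_mul]

lemma HasSystem.of_iso {A B : FDRep k G} {ε : k} {x : ℕ} (h : HasSystem z A.ρ ε x) (i : A ≅ B) :
    HasSystem z B.ρ ε x := by
  refine h.of_equiv (FDRep.isoToLinearEquiv i) fun g m => ?_
  rw [FDRep.Iso.conj_ρ i g]
  simp [LinearEquiv.conj_apply]

lemma HasSystem.tensor {A B : FDRep k G} {ε : k} {x : ℕ}
    (h : HasSystem z (Representation.tprod A.ρ B.ρ) ε x) : HasSystem z (A ⊗ B : FDRep k G).ρ ε x := h

lemma exists_hasSystem_tpow [Fintype G] (V : FDRep k G) (h2 : (2 : k) ≠ 0) (hz : z ≠ 1)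
    (hz2 : z * z = 1) (hVz : ∀ v, V.ρ z v = -v)
    (hV : ∀ g : G, g ≠ 1 → g ≠ z → ∃ (v : V) (f : Module.Dual k V), f v = 1 ∧ f (V.ρ g v) = 0)
    (hdim : Module.finrank k V = 2) {D N : ℕ} (hD : 2 * D = Fintype.card G)
    (hN : N + 2 = Fintype.card G) (m s : ℕ) :
    ∃ x, x * D + (2 ^ N - D) ^ m = 2 ^ (m * N) ∧
      HasSystem z (tpow V (m * N + s)).ρ ((-1) ^ s) (x * 2 ^ s) := by
  classical
  have hNe : Even N := ⟨D - 1, by omega⟩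
  have hDN : D ≤ 2 ^ N := by
    have h : N < 2 ^ N := Nat.lt_two_pow_self
    omega
  have hone : HasSystem z (tpow V N).ρ 1 1 := by
    have hS : (Finset.univ.erase 1 |>.erase z : Finset G).card = N := by
      rw [Finset.card_erase_of_mem (by simp [hz]), Finset.card_erase_of_mem (by simp),
        Finset.card_univ]
      omega
    obtain ⟨v, f, h1, h0⟩ := exists_coeff_tpow (z := z) V hV (Finset.univ.erase 1 |>.erase z)
      (by simp +contextual) hS
    refine ⟨fun _ => v, fun _ => f, fun i j g => ?_⟩
    rw [if_pos (Subsingleton.elim _ _), twoPoint]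
    split_ifs with hg1 hgz
    · rw [hg1, map_one, Module.End.one_apply, h1]
    · rw [hgz, tpow_apply_of_apply_eq_neg V hVz, hNe.neg_one_pow, one_smul, h1]
    · exact h0 g (by simp [hg1, hgz])
  have hact : ∀ m, (tpow V (m * N)).ρ z = 1 := fun m => by
    ext a
    rw [tpow_apply_of_apply_eq_neg V hVz, (hNe.mul_left m).neg_one_pow, one_smul]
    rfl
  have main : ∀ m, ∃ x, x * D + (2 ^ N - D) ^ m = 2 ^ (m * N) ∧
      HasSystem z (tpow V (m * N)).ρ 1 x := by
    intro m
    induction m with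
    | zero => exact ⟨0, by simp, Fin.elim0, Fin.elim0, fun i => i.elim0⟩
    | succ m ih =>
      obtain ⟨x, hx, h⟩ := ih
      refine ⟨x * 2 ^ N + (2 ^ N - D) ^ m, ?_, ?_⟩
      · obtain ⟨c, hc⟩ := Nat.exists_eq_add_of_le hDN
        rw [add_mul m, one_mul, pow_add _ (m * N), ← hx, pow_succ, hc, Nat.add_sub_cancel_left]
        ring
      · obtain ⟨i⟩ := nonempty_tpow_add_iso V (m * N) N
        have hNact : (tpow V N).ρ z = 1 := by
          ext a
          rw [tpow_apply_of_apply_eq_neg V hVz, hNe.neg_one_pow, one_smul]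
          rfl
        have := HasSystem.step h2 hz hz2 (hact m) hNact h hone hD
          (by rw [hx, finrank_tpow, hdim])
        rw [finrank_tpow, hdim] at this
        rw [add_mul, one_mul]
        exact this.tensor.of_iso i.symm
  obtain ⟨x, hx, h⟩ := main m
  refine ⟨x, hx, ?_⟩
  obtain ⟨i⟩ := nonempty_tpow_add_iso V (m * N) s
  have := h.tprod (tpow_apply_of_apply_eq_neg V hVz s)
  rw [finrank_tpow, hdim, one_mul] at this
  exact this.tensor.of_iso i.symm

end TensorPowers
end
end SLTwo

namespace SLTwo
noncomputable section
section Homs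

variable {k G : Type} [Field k] [Group G]

/-- The morphism of representations attached to an equivariant linear map. -/
def homOfLin {A B : FDRep k G} (f : A →ₗ[k] B) (hf : ∀ g a, f (A.ρ g a) = B.ρ g (f a)) : A ⟶ B :=
  ⟨InducedCategory.homMk (ModuleCat.ofHom f), fun g => by
    ext1
    exact show f ∘ₗ A.ρ g = B.ρ g ∘ₗ f from LinearMap.ext fun a => hf g a⟩

/-- The linear map underlying a morphism of representations. -/
def homLin {A B : FDRep k G} (f : A ⟶ B) : A →ₗ[k] B := f.hom.hom.hom

lemma homLin_injective {A B : FDRep k G} : Function.Injective (homLin : (A ⟶ B) → _) := by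
  intro f g h
  refine Action.Hom.ext (InducedCategory.hom_ext (ModuleCat.hom_ext h))

lemma homLin_comp {A B C : FDRep k G} (f : A ⟶ B) (g : B ⟶ C) :
    homLin (f ≫ g) = homLin g ∘ₗ homLin f := rfl

lemma homLin_id (A : FDRep k G) : homLin (𝟙 A) = LinearMap.id := rfl

lemma homLin_zero {A B : FDRep k G} : homLin (0 : A ⟶ B) = 0 := rfl

lemma homLin_equivariant {A B : FDRep k G} (f : A ⟶ B) (g : G) (a : A) :
    homLin f (A.ρ g a) = B.ρ g (homLin f a) :=
  LinearMap.congr_fun (congrArg (fun x => x.hom.hom) (f.comm g)) a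

lemma finrank_eq_of_iso {A B : FDRep k G} (i : A ≅ B) :
    Module.finrank k A = Module.finrank k B :=
  (FDRep.isoToLinearEquiv i).finrank_eq

lemma one_le_finrank_of_indecomposable {A : FDRep k G} (h : Indecomposable A) :
    1 ≤ Module.finrank k A := by
  rw [Nat.one_le_iff_ne_zero]
  intro h0
  have := Module.finrank_zero_iff.1 h0
  refine h.1 ((IsZero.iff_id_eq_zero A).2 (homLin_injective (LinearMap.ext fun a => ?_)))
  exact Subsingleton.elim _ _

lemma sum_finrank_le_of_iso {M : FDRep k G} {n : ℕ} {W : Fin n → FDRep k G} (i : M ≅ ⨁ W) :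
    ∑ t, Module.finrank k (W t) ≤ Module.finrank k M := by
  rw [finrank_eq_of_iso i, ← Module.finrank_pi_fintype]
  let F : (∀ t, W t) →ₗ[k] (⨁ W : FDRep k G) :=
    ∑ t, homLin (biproduct.ι W t) ∘ₗ LinearMap.proj t
  refine LinearMap.finrank_le_finrank_of_injective (f := F) fun w w' h => funext fun s => ?_
  have key : ∀ w, homLin (biproduct.π W s) (F w) = w s := by
    intro w
    simp only [F, LinearMap.sum_apply, map_sum, LinearMap.comp_apply, LinearMap.proj_apply]
    rw [Finset.sum_eq_single s]
    · rw [← LinearMap.comp_apply, ← homLin_comp, biproduct.ι_π_self, homLin_id, LinearMap.id_apply]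
    · intro t _ ht
      rw [← LinearMap.comp_apply, ← homLin_comp, biproduct.ι_π_ne _ ht, homLin_zero,
        LinearMap.zero_apply]
    · simp
  rw [← key w, h, key]

/-- The regular representation of a finite group on its functions. -/
def regRep (k G : Type) [Field k] [Group G] : Representation k G (G → k) where
  toFun h := LinearMap.funLeft k k fun g => h⁻¹ * g
  map_one' := by ext; simp [LinearMap.funLeft]
  map_mul' a b := by ext; simp [LinearMap.funLeft, mul_assoc]

/-- The averaging map attached to a vector. -/
def averageMap [Fintype G] (M : FDRep k G) (v : M) : FDRep.of (regRep k G) ⟶ M :=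
  homOfLin (A := FDRep.of (regRep k G))
    ((2 : k)⁻¹ • ∑ g, (LinearMap.proj g : (G → k) →ₗ[k] k).smulRight (M.ρ g v)) fun h φ => by
    change G → k at φ
    simp only [LinearMap.smul_apply, LinearMap.sum_apply, LinearMap.smulRight_apply,
      map_smul, map_sum]
    congr 1
    refine Fintype.sum_bijective (h⁻¹ * ·) (Group.mulLeft_bijective _) _ _ fun g => ?_
    rw [← Module.End.mul_apply, ← map_mul, mul_inv_cancel_left]
    rfl

lemma homLin_averageMap [Fintype G] (M : FDRep k G) (v : M) (φ : G → k) :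
    homLin (averageMap M v) φ = (2 : k)⁻¹ • ∑ g, φ g • M.ρ g v := by
  change ((2 : k)⁻¹ • ∑ g, (LinearMap.proj g : (G → k) →ₗ[k] k).smulRight (M.ρ g v)) φ = _
  simp

/-- The matrix coefficient map attached to a functional. -/
def matrixCoeffMap [Finite G] (M : FDRep k G) (f : Module.Dual k M) : M ⟶ FDRep.of (regRep k G) :=
  homOfLin (B := FDRep.of (regRep k G)) (LinearMap.pi fun g => f ∘ₗ M.ρ g⁻¹) fun h m => by
    refine funext fun g => ?_
    change f (M.ρ g⁻¹ (M.ρ h m)) = f (M.ρ (h⁻¹ * g)⁻¹ m)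
    rw [← Module.End.mul_apply, ← map_mul, mul_inv_rev, inv_inv]

lemma homLin_averageMap_comp_matrixCoeffMap [Fintype G] {M : FDRep k G} {z : G} (hz : z ≠ 1)
    (v : M) (f : Module.Dual k M) {ε : k} {P : Prop} [Decidable P]
    (h : ∀ g, f (M.ρ g v) = if P then twoPoint z ε g else 0) (φ : G → k) (g : G) :
    (homLin (averageMap M v ≫ matrixCoeffMap M f) φ : G → k) g =
      if P then (2 : k)⁻¹ * (φ g + ε * φ (g * z)) else 0 := by
  change f (M.ρ g⁻¹ (homLin (averageMap M v) φ)) = _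
  rw [homLin_averageMap, map_smul, map_smul, map_sum, map_sum]
  have e : ∀ x, f (M.ρ g⁻¹ (φ x • M.ρ x v)) = φ x * f (M.ρ (g⁻¹ * x) v) := fun x => by
    rw [map_smul, map_smul, map_mul]
    rfl
  rw [Finset.sum_congr rfl fun x _ => e x]
  split_ifs with hP
  · rw [smul_eq_mul]
    congr 1
    classical
    have e' : ∀ x, φ x * f (M.ρ (g⁻¹ * x) v) =
        (if x = g then φ g else 0) + if x = g * z then ε * φ (g * z) else 0 := by
      intro x
      rw [h, if_pos hP, twoPoint]
      by_cases h1 : x = g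
      · subst h1; simp [hz]
      · by_cases h2 : x = g * z
        · subst h2; simp [hz, mul_comm]
        · simp [h1, h2, inv_mul_eq_iff_eq_mul]
    rw [Finset.sum_congr rfl fun x _ => e' x, Finset.sum_add_distrib]
    simp
  · rw [Finset.sum_eq_zero fun x _ => by rw [h, if_neg hP, mul_zero], smul_zero]

end Homs
end
end SLTwo

namespace SLTwo
open Matrix
variable {p : ℕ} [Fact p.Prime]

lemma natRep_apply (g : SpecialLinearGroup (Fin 2) (ZMod p)) (v : Fin 2 → ZMod p) :
    natRep p g v = (g : Matrix (Fin 2) (Fin 2) (ZMod p)) *ᵥ v := rfl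

lemma natRep_neg_one (v : Fin 2 → ZMod p) : natRep p (-1) v = -v := by
  rw [natRep_apply]
  simp [Matrix.neg_mulVec]

lemma exists_coeff_natRep (g : SpecialLinearGroup (Fin 2) (ZMod p)) (h1 : g ≠ 1) (h2 : g ≠ -1) :
    ∃ (v : Fin 2 → ZMod p) (f : Module.Dual (ZMod p) (Fin 2 → ZMod p)),
      f v = 1 ∧ f (natRep p g v) = 0 := by
  let f (α β : ZMod p) : Module.Dual (ZMod p) (Fin 2 → ZMod p) :=
    α • LinearMap.proj 0 + β • LinearMap.proj 1
  have hf : ∀ α β v, f α β v = α * v 0 + β * v 1 := fun α β v => rfl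
  have hdet : g 0 0 * g 1 1 - g 0 1 * g 1 0 = 1 := by rw [← det_fin_two, g.2]
  by_cases h10 : g 1 0 = 0
  · by_cases h01 : g 0 1 = 0
    · rw [h10, h01, mul_zero, sub_zero] at hdet
      have h : g 0 0 - g 1 1 ≠ 0 := by
        intro h
        have h11 : g 1 1 = g 0 0 := (sub_eq_zero.1 h).symm
        rw [h11] at hdet
        rcases mul_self_eq_one_iff.1 hdet with h | h
        · apply h1
          ext i j
          fin_cases i <;> fin_cases j <;> simp [h, h11, h10, h01]
        · apply h2
          ext i j
          fin_cases i <;> fin_cases j <;> simp [h, h11, h10, h01]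
      refine ⟨![1, 1], f (-g 1 1 / (g 0 0 - g 1 1)) (g 0 0 / (g 0 0 - g 1 1)), ?_, ?_⟩
      · rw [hf]
        simp only [cons_val_zero, cons_val_one, mul_one]
        field_simp
        ring
      · rw [hf, natRep_apply]
        simp only [mulVec, dotProduct, Fin.sum_univ_two, cons_val_zero, cons_val_one, mul_one,
          h10, h01]
        field_simp
        ring
    · refine ⟨![0, 1], f (-g 1 1 / g 0 1) 1, ?_, ?_⟩
      · rw [hf]
        simp
      · rw [hf, natRep_apply]
        simp only [mulVec, dotProduct, Fin.sum_univ_two, cons_val_zero, cons_val_one]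
        field_simp
        ring
  · refine ⟨![1, 0], f 1 (-g 0 0 / g 1 0), ?_, ?_⟩
    · rw [hf]
      simp
    · rw [hf, natRep_apply]
      simp only [mulVec, dotProduct, Fin.sum_univ_two, cons_val_zero, cons_val_one]
      field_simp
      ring

lemma neg_one_ne_one {p : ℕ} (hp : 2 < p) : (-1 : SpecialLinearGroup (Fin 2) (ZMod p)) ≠ 1 := by
  intro h
  have : Fact (2 < p) := ⟨hp⟩
  have := congrArg (fun g : SpecialLinearGroup (Fin 2) (ZMod p) => g 0 0) h
  exact ZMod.neg_one_ne_one (by simpa using this)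

lemma card_specialLinearGroup [Fintype (SpecialLinearGroup (Fin 2) (ZMod p))] :
    Fintype.card (SpecialLinearGroup (Fin 2) (ZMod p)) = p * (p ^ 2 - 1) := by
  let d : GL (Fin 2) (ZMod p) →* (ZMod p)ˣ := GeneralLinearGroup.det
  have hd : Function.Surjective d := by
    intro u
    refine ⟨GeneralLinearGroup.mkOfDetNeZero !![(u : ZMod p), 0; 0, 1] (by simp), ?_⟩
    ext
    simp [d, GeneralLinearGroup.mkOfDetNeZero]
  have hk : Nat.card d.ker = Fintype.card (SpecialLinearGroup (Fin 2) (ZMod p)) := by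
    have hmem : ∀ g : SpecialLinearGroup (Fin 2) (ZMod p), SpecialLinearGroup.toGL g ∈ d.ker := by
      intro g
      rw [MonoidHom.mem_ker]
      ext
      simp [d]
    rw [← Nat.card_eq_fintype_card]
    refine (Nat.card_congr (Equiv.ofBijective
      (fun g => (⟨SpecialLinearGroup.toGL g, hmem g⟩ : d.ker)) ⟨?_, ?_⟩)).symm
    · intro g h hgh
      have := congrArg (fun x : d.ker => (x.1 : Matrix (Fin 2) (Fin 2) (ZMod p))) hgh
      exact Subtype.ext this
    · rintro ⟨g, hg⟩
      rw [MonoidHom.mem_ker] at hg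
      refine ⟨⟨g, congrArg Units.val hg⟩, ?_⟩
      ext
      rfl
  have h := d.ker.card_mul_index
  rw [Subgroup.index_ker, MonoidHom.range_eq_top.2 hd, Subgroup.card_top, hk,
    Matrix.card_GL_field, Fin.prod_univ_two, Nat.card_eq_fintype_card, ZMod.card_units_eq_totient,
    Nat.totient_prime Fact.out, ZMod.card] at h
  have hp := (Fact.out : p.Prime).two_le
  obtain ⟨q, rfl⟩ : ∃ q, p = q + 1 := ⟨p - 1, by omega⟩
  have e : (q + 1) ^ 2 - (q + 1) ^ 1 = (q + 1) * q := by
    rw [pow_two, pow_one, Nat.mul_add, mul_one, Nat.add_sub_cancel]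
  simp only [Fin.val_zero, Fin.val_one, pow_zero, e, Nat.add_sub_cancel] at h
  have hq : 0 < q := by omega
  apply Nat.eq_of_mul_eq_mul_right hq
  rw [h]
  ring

end SLTwo

namespace SLTwo
noncomputable section
open Matrix

variable {p : ℕ} [Fact p.Prime]

variable (p) in
/-- The regular representation of `SL₂(F_p)`. -/
abbrev regFD : FDRep (ZMod p) (SpecialLinearGroup (Fin 2) (ZMod p)) :=
  FDRep.of (regRep (ZMod p) (SpecialLinearGroup (Fin 2) (ZMod p)))

/-- The endomorphism of the regular representation attached to an algebra element. -/
def algHom (a : Alg p) : regFD p ⟶ regFD p :=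
  homOfLin (A := regFD p) (B := regFD p) a.1 fun g φ => (leftTr_smul a g φ).symm

/-- The algebra element attached to an endomorphism of the regular representation. -/
def algOf (f : regFD p ⟶ regFD p) : Alg p :=
  ⟨homLin f, by
    rw [algSub, Subalgebra.mem_centralizer_iff]
    rintro _ ⟨g, rfl⟩
    exact LinearMap.ext fun φ => (homLin_equivariant f g φ).symm⟩

lemma homLin_algHom (a : Alg p) (φ : Fn p) : homLin (algHom a) φ = a • φ := rfl

lemma algOf_algHom (a : Alg p) : algOf (algHom a) = a := rfl

lemma algHom_algOf (f : regFD p ⟶ regFD p) : algHom (algOf f) = f := homLin_injective rfl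

lemma algHom_mul (a b : Alg p) : algHom (a * b) = algHom b ≫ algHom a := homLin_injective rfl

lemma algHom_zero : algHom (0 : Alg p) = 0 := homLin_injective rfl

lemma algOf_comp (f g : regFD p ⟶ regFD p) : algOf (f ≫ g) = algOf g * algOf f := rfl

lemma algOf_add (f g : regFD p ⟶ regFD p) : algOf (f + g) = algOf f + algOf g := rfl

variable (p) in
/-- The indices of a given parity. -/
def idxParity (ε : ZMod p) : Finset (Idx p) :=
  Finset.univ.filter fun j => (-1) ^ (j.1 : ℕ) = ε

variable (p) in
/-- A decomposition of the regular representation attached to the idempotents. -/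
structure ProjSystem where
  /-- the idempotents -/
  e : Idx p → Alg p
  coi : CompleteOrthogonalIdempotents e
  act_e : ∀ j, act p (e j) = rankOne j
  /-- the summands -/
  obj : Idx p → FDRep (ZMod p) (SpecialLinearGroup (Fin 2) (ZMod p))
  /-- the inclusions -/
  ι : ∀ j, obj j ⟶ regFD p
  /-- the projections -/
  π : ∀ j, regFD p ⟶ obj j
  ι_π : ∀ j, ι j ≫ π j = 𝟙 _
  π_ι : ∀ j, π j ≫ ι j = algHom (e j)

lemma nonempty_projSystem : Nonempty (ProjSystem p) := by
  obtain ⟨e, coi, he⟩ := exists_idempotents p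
  have : IsIdempotentComplete (FDRep (ZMod p) (SpecialLinearGroup (Fin 2) (ZMod p))) :=
    (Idempotents.isIdempotentComplete_iff_idempotents_have_kernels _).2
      fun _ _ _ => inferInstance
  have h := fun j => IsIdempotentComplete.idempotents_split (regFD p) (algHom (e j))
    (by rw [← algHom_mul, (coi.idem j).eq])
  choose P ι π h1 h2 using h
  exact ⟨⟨e, coi, he, P, ι, π, h1, h2⟩⟩

namespace ProjSystem
variable (S : ProjSystem p)

lemma exists_local_functional (j : Idx p) : ∃ κ : (S.obj j ⟶ S.obj j) →+ ZMod p,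
    κ (𝟙 _) ≠ 0 ∧ ∀ h, κ h ≠ 0 → IsIso h := by
  let κ : (S.obj j ⟶ S.obj j) →+ ZMod p :=
    AddMonoidHom.mk' (fun h => diagCoeff j (algOf (S.π j ≫ h ≫ S.ι j))) fun f g => by
      rw [Preadditive.add_comp, Preadditive.comp_add, algOf_add, map_add]
  have hκ : ∀ h, κ h = diagCoeff j (algOf (S.π j ≫ h ≫ S.ι j)) := fun h => rfl
  refine ⟨κ, ?_, fun h hh => ?_⟩
  · rw [hκ, Category.id_comp, S.π_ι, algOf_algHom, diagCoeff_self (S.act_e j)]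
    exact one_ne_zero
  · have hι := S.ι_π j
    have he : algOf (S.π j ≫ S.ι j) = S.e j := by rw [S.π_ι, algOf_algHom]
    obtain ⟨h', -, h2, h3⟩ := exists_corner_inverse (S.coi.idem j).eq (S.act_e j)
      (h := algOf (S.π j ≫ h ≫ S.ι j))
      (by rw [← he, ← algOf_comp, ← algOf_comp]; simp [reassoc_of% hι]) hh
    have e1 : algHom h' ≫ S.π j ≫ h ≫ S.ι j = S.π j ≫ S.ι j := by
      rw [S.π_ι, ← h2, algHom_mul, algHom_algOf]
    have e2 : (S.π j ≫ h ≫ S.ι j) ≫ algHom h' = S.π j ≫ S.ι j := by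
      rw [S.π_ι, ← h3, algHom_mul, algHom_algOf]
    refine ⟨S.ι j ≫ algHom h' ≫ S.π j, ?_, ?_⟩
    · have := congrArg (fun x => S.ι j ≫ x ≫ S.π j) e2
      simpa [reassoc_of% hι, hι] using this
    · have := congrArg (fun x => S.ι j ≫ x ≫ S.π j) e1
      simpa [reassoc_of% hι, hι] using this

lemma parity_mul_e (hp : 2 < p) {ε : ZMod p} (hε : ε = 1 ∨ ε = -1) (j : Idx p) :
    parity ε * S.e j = if j ∈ idxParity p ε then S.e j else 0 := by
  have h := parity_mul_eq hp (S.coi.idem j).eq (S.act_e j)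
  split_ifs with hj
  · rw [idxParity, Finset.mem_filter] at hj
    rw [← hj.2]
    exact h.1
  · have : ε = -(-1) ^ (j.1 : ℕ) := by
      have hj : (-1) ^ (j.1 : ℕ) ≠ ε := by simpa [idxParity] using hj
      rcases neg_one_pow_eq_or (ZMod p) (j.1 : ℕ) with h1 | h1 <;> rcases hε with h2 | h2 <;>
        simp_all
    rw [this]
    exact h.2

lemma parity_eq_sum (hp : 2 < p) {ε : ZMod p} (hε : ε = 1 ∨ ε = -1) :
    parity ε = ∑ j ∈ idxParity p ε, S.e j := by
  rw [← mul_one (parity ε), ← S.coi.complete, Finset.mul_sum,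
    Finset.sum_congr rfl fun j _ => S.parity_mul_e hp hε j, Finset.sum_ite_mem,
    Finset.univ_inter]

end ProjSystem

lemma parity_smul_apply (ε : ZMod p) (φ : Fn p) (g : SpecialLinearGroup (Fin 2) (ZMod p)) :
    (parity ε • φ) g = 2⁻¹ * (φ g + ε * φ (g * -1)) := by
  rw [parity, smul_assoc, add_smul, one_smul, smul_assoc]
  rfl

/-- A nowhere vanishing odd function. -/
def oddFn (g : SpecialLinearGroup (Fin 2) (ZMod p)) : ZMod p := if g 0 0 = 0 then g 1 0 else g 0 0

lemma oddFn_ne_zero (g : SpecialLinearGroup (Fin 2) (ZMod p)) : oddFn g ≠ 0 := by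
  unfold oddFn
  split_ifs with h
  · intro h'
    have := g.2
    rw [det_fin_two, h, h'] at this
    simp at this
  · exact h

lemma oddFn_mul_neg_one (g : SpecialLinearGroup (Fin 2) (ZMod p)) :
    oddFn (g * -1) = -oddFn g := by
  have h : ∀ i j, (g * -1) i j = -g i j := fun i j => by
    rw [mul_neg, mul_one, SpecialLinearGroup.coe_neg]
    rfl
  unfold oddFn
  rw [h, h]
  by_cases h0 : g 0 0 = 0
  · rw [if_pos h0, if_pos (by rw [h0, neg_zero])]
  · rw [if_neg h0, if_neg (by rwa [neg_eq_zero])]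

lemma finrank_range_parity_le (ε : ZMod p) :
    Module.finrank (ZMod p) (LinearMap.range (parity ε : Alg p).1) ≤
      Module.finrank (ZMod p) (LinearMap.range (parity (-ε) : Alg p).1) := by
  let m : Fn p →ₗ[ZMod p] Fn p := LinearMap.mulLeft (ZMod p) oddFn
  have hm : Function.Injective m := fun φ ψ h => funext fun g =>
    mul_left_cancel₀ (oddFn_ne_zero g) (congrFun h g)
  rw [(Submodule.equivMapOfInjective m hm _).finrank_eq]
  apply Submodule.finrank_mono
  rintro _ ⟨_, ⟨φ, rfl⟩, rfl⟩
  refine ⟨m φ, funext fun g => ?_⟩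
  change (parity (-ε) • (oddFn * φ : Fn p) : Fn p) g = oddFn g * (parity ε • φ : Fn p) g
  rw [parity_smul_apply, parity_smul_apply]
  simp only [Pi.mul_apply, oddFn_mul_neg_one]
  ring

lemma le_finrank_range_parity (hp : 2 < p) (ε : ZMod p) {D : ℕ}
    (hD : 2 * D = Fintype.card (SpecialLinearGroup (Fin 2) (ZMod p))) :
    D ≤ Module.finrank (ZMod p) (LinearMap.range (parity ε : Alg p).1) := by
  have h1 := finrank_range_parity_le (-ε)
  rw [neg_neg] at h1
  have h2 : Module.finrank (ZMod p) (Fn p) ≤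
      Module.finrank (ZMod p) (LinearMap.range (parity ε : Alg p).1) +
        Module.finrank (ZMod p) (LinearMap.range (parity (-ε) : Alg p).1) := by
    have h := Submodule.finrank_add_le_finrank_add_finrank
      (LinearMap.range (parity ε : Alg p).1) (LinearMap.range (parity (-ε) : Alg p).1)
    have htop : LinearMap.range (parity ε : Alg p).1 ⊔ LinearMap.range (parity (-ε) : Alg p).1 =
        ⊤ := by
      rw [eq_top_iff]
      rintro φ -
      have : φ = (parity ε : Alg p) • φ + (parity (-ε) : Alg p) • φ := by
        rw [← add_smul, parity_add_parity_neg hp, one_smul]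
      rw [this]
      exact Submodule.add_mem_sup ⟨φ, rfl⟩ ⟨φ, rfl⟩
    rw [htop, finrank_top] at h
    exact h
  rw [Module.finrank_pi, ← hD] at h2
  omega

namespace ProjSystem
variable (S : ProjSystem p)

lemma le_sum_finrank_obj (hp : 2 < p) {ε : ZMod p} (hε : ε = 1 ∨ ε = -1) {D : ℕ}
    (hD : 2 * D = Fintype.card (SpecialLinearGroup (Fin 2) (ZMod p))) :
    D ≤ ∑ j ∈ idxParity p ε, Module.finrank (ZMod p) (S.obj j) := by
  let F : (∀ j : idxParity p ε, S.obj j) →ₗ[ZMod p] Fn p :=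
    ∑ j : idxParity p ε, homLin (S.ι j) ∘ₗ LinearMap.proj j
  have h1 : LinearMap.range (parity ε : Alg p).1 ≤ LinearMap.range F := by
    rintro _ ⟨φ, rfl⟩
    refine ⟨fun j => homLin (S.π j) φ, ?_⟩
    change _ = parity ε • φ
    rw [S.parity_eq_sum hp hε, Finset.sum_smul, ← Finset.sum_coe_sort]
    simp only [F, LinearMap.sum_apply]
    refine Finset.sum_congr rfl fun j _ => ?_
    change homLin (S.π j ≫ S.ι j) φ = _
    rw [S.π_ι, homLin_algHom]
  refine (le_finrank_range_parity hp ε hD).trans ((Submodule.finrank_mono h1).trans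
    ((LinearMap.finrank_range_le F).trans ?_))
  rw [Module.finrank_pi_fintype, ← Finset.sum_coe_sort (idxParity p ε)]

end ProjSystem

lemma card_summands_bounds (hp : 2 < p)
    (M : FDRep (ZMod p) (SpecialLinearGroup (Fin 2) (ZMod p)))
    {ε : ZMod p} (hε : ε = 1 ∨ ε = -1) {x : ℕ} (hM : HasSystem (-1) M.ρ ε x) {n : ℕ}
    {W : Fin n → FDRep (ZMod p) (SpecialLinearGroup (Fin 2) (ZMod p))}
    (hW : ∀ t, Indecomposable (W t)) (i : M ≅ ⨁ W) {D : ℕ}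
    (hD : 2 * D = Fintype.card (SpecialLinearGroup (Fin 2) (ZMod p))) :
    x * (idxParity p ε).card ≤ n ∧
      n + x * D ≤ x * (idxParity p ε).card + Module.finrank (ZMod p) M := by
  obtain ⟨S⟩ := nonempty_projSystem (p := p)
  obtain ⟨v, f, hvf⟩ := hM
  have hcomp : ∀ a b, averageMap M (v a) ≫ matrixCoeffMap M (f b) =
      if b = a then algHom (parity ε) else 0 := by
    intro a b
    refine homLin_injective (LinearMap.ext fun φ => funext fun g => ?_)
    refine (homLin_averageMap_comp_matrixCoeffMap (neg_one_ne_one hp) (v a) (f b) (hvf b a) φ g).trans ?_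
    split_ifs
    · exact (parity_smul_apply ε φ g).symm
    · rfl
  let α := Fin x × Idx p
  let X (j : α) (t : Fin n) : S.obj j.2 ⟶ W t :=
    S.ι j.2 ≫ averageMap M (v j.1) ≫ i.hom ≫ biproduct.π W t
  let Y (t : Fin n) (j : α) : W t ⟶ S.obj j.2 :=
    biproduct.ι W t ≫ i.inv ≫ matrixCoeffMap M (f j.1) ≫ S.π j.2
  have hXY : ∀ j j' : α, ∑ t, X j t ≫ Y t j' =
      S.ι j.2 ≫ (if j'.1 = j.1 then algHom (parity ε) else 0) ≫ S.π j'.2 := by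
    intro j j'
    have : ∀ t, X j t ≫ Y t j' = (S.ι j.2 ≫ averageMap M (v j.1) ≫ i.hom) ≫
        (biproduct.π W t ≫ biproduct.ι W t) ≫ i.inv ≫ matrixCoeffMap M (f j'.1) ≫ S.π j'.2 := by
      intro t
      simp [X, Y]
    rw [Finset.sum_congr rfl fun t _ => this t, ← Preadditive.comp_sum, ← Preadditive.sum_comp,
      biproduct.total, ← hcomp]
    simp
  have hι : ∀ j ∈ idxParity p ε, S.ι j ≫ algHom (parity ε) = S.ι j := by
    intro j hj
    have h1 : S.ι j = S.ι j ≫ algHom (S.e j) := by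
      rw [← S.π_ι, ← Category.assoc, S.ι_π, Category.id_comp]
    rw [h1, Category.assoc, ← algHom_mul, S.parity_mul_e hp hε, if_pos hj]
  have hιπ : ∀ j j', j ≠ j' → S.ι j ≫ S.π j' = 0 := by
    intro j j' hj
    have h1 : S.ι j = S.ι j ≫ algHom (S.e j) := by
      rw [← S.π_ι, ← Category.assoc, S.ι_π, Category.id_comp]
    have h2 : S.π j' = algHom (S.e j') ≫ S.π j' := by
      rw [← S.π_ι, Category.assoc, S.ι_π, Category.comp_id]
    rw [h1, h2, Category.assoc, ← Category.assoc (algHom _), ← algHom_mul,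
      S.coi.ortho hj.symm, algHom_zero, zero_comp, comp_zero]
  have key := matching (fun j : α => S.obj j.2) W hW (fun j => S.exists_local_functional j.2)
    (fun A => Module.finrank (ZMod p) A) (fun _ _ i => finrank_eq_of_iso i)
    (fun t => one_le_finrank_of_indecomposable (hW t))
    (Finset.univ ×ˢ idxParity p ε) Finset.univ X Y
    (fun j hj => by
      rw [hXY, if_pos rfl, ← Category.assoc, hι _ (Finset.mem_product.1 hj).2, S.ι_π])
    (fun j hj j' _ hjj' => by
      rw [hXY]
      split_ifs with h
      · rw [← Category.assoc, hι _ (Finset.mem_product.1 hj).2]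
        exact hιπ _ _ fun h' => hjj' (Prod.ext h.symm h')
      · rw [zero_comp, comp_zero])
  rw [Finset.card_product, Finset.card_univ, Finset.card_univ, Fintype.card_fin, Fintype.card_fin,
    Finset.sum_product] at key
  refine ⟨key.1, ?_⟩
  have h1 := S.le_sum_finrank_obj hp hε hD
  have h2 := sum_finrank_le_of_iso i
  have h3 : n + ∑ _a : Fin x, ∑ j ∈ idxParity p ε, Module.finrank (ZMod p) (S.obj j) ≤
      x * (idxParity p ε).card + ∑ t, Module.finrank (ZMod p) (W t) := key.2
  rw [Finset.sum_const, Finset.card_univ, Fintype.card_fin, smul_eq_mul] at h3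
  have h4 := Nat.mul_le_mul_left x h1
  omega

end
end SLTwo

namespace SLTwo
open Matrix

variable {p : ℕ} [Fact p.Prime]

lemma card_idxParity_eq_sum (ε : ZMod p) :
    (idxParity p ε).card = ∑ r ∈ Finset.range p, if (-1 : ZMod p) ^ r = ε then r + 1 else 0 := by
  rw [idxParity, Finset.card_filter, Fintype.sum_sigma, ← Fin.sum_univ_eq_sum_range
    (fun r => if (-1 : ZMod p) ^ r = ε then r + 1 else 0)]
  refine Finset.sum_congr rfl fun r _ => ?_
  dsimp only
  split_ifs <;> simp

lemma sum_range_even (q : ℕ) :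
    ∑ r ∈ Finset.range (2 * q + 1), (if Even r then r + 1 else 0) = (q + 1) ^ 2 := by
  induction q with
  | zero => rfl
  | succ q ih =>
    rw [show 2 * (q + 1) + 1 = 2 * q + 1 + 1 + 1 by ring, Finset.sum_range_succ,
      Finset.sum_range_succ, ih, if_neg (by simp [parity_simps]), if_pos (by simp [parity_simps])]
    ring

lemma sum_range_odd (q : ℕ) :
    ∑ r ∈ Finset.range (2 * q + 1), (if Odd r then r + 1 else 0) = q * (q + 1) := by
  induction q with
  | zero => rfl
  | succ q ih =>
    rw [show 2 * (q + 1) + 1 = 2 * q + 1 + 1 + 1 by ring, Finset.sum_range_succ,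
      Finset.sum_range_succ, ih, if_pos (by simp [parity_simps]), if_neg (by simp [parity_simps])]
    ring

lemma card_idxParity_one (hp : 2 < p) {q : ℕ} (hq : p = 2 * q + 1) :
    (idxParity p (1 : ZMod p)).card = (q + 1) ^ 2 := by
  have : Fact (2 < p) := ⟨hp⟩
  rw [card_idxParity_eq_sum, ← sum_range_even, ← hq]
  simp only [neg_one_pow_eq_one_iff_even (ZMod.neg_one_ne_one (n := p))]

lemma card_idxParity_neg_one (hp : 2 < p) {q : ℕ} (hq : p = 2 * q + 1) :
    (idxParity p (-1 : ZMod p)).card = q * (q + 1) := by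
  have : Fact (2 < p) := ⟨hp⟩
  rw [card_idxParity_eq_sum, ← sum_range_odd, ← hq]
  simp only [neg_one_pow_eq_neg_one_iff_odd (ZMod.neg_one_ne_one (n := p))]

lemma mul_eq_card_idxParity (hp : 2 < p) {D : ℕ}
    (hD : 2 * D = Fintype.card (SpecialLinearGroup (Fin 2) (ZMod p))) (n : ℕ) :
    ((1 : ℝ) / (2 * p - 2) + (-1 : ℝ) ^ n / (2 * p ^ 2 - 2 * p)) * D =
      (idxParity p ((-1 : ZMod p) ^ n)).card := by
  obtain ⟨q, hq⟩ : ∃ q, p = 2 * q + 1 :=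
    ((Fact.out : p.Prime).odd_of_ne_two (by omega))
  have hq0 : (q : ℝ) ≠ 0 := by
    have : q ≠ 0 := by omega
    exact_mod_cast this
  have hq1 : (2 * q + 1 : ℝ) ≠ 0 := by positivity
  have hDq : D = (2 * q + 1) * (2 * q * (q + 1)) := by
    have h1 : p ^ 2 - 1 = 2 * (2 * q * (q + 1)) := by
      rw [hq, Nat.sub_eq_iff_eq_add (Nat.one_le_pow _ _ (by omega))]
      ring
    rw [card_specialLinearGroup, h1] at hD
    apply Nat.eq_of_mul_eq_mul_left (Nat.succ_pos 1)
    rw [hD, hq]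
    ring
  have hpq : (p : ℝ) = 2 * q + 1 := by rw [hq]; push_cast; ring
  have e1 : (2 * p - 2 : ℝ) = 4 * q := by rw [hpq]; ring
  have e2 : (2 * p ^ 2 - 2 * p : ℝ) = 4 * q * (2 * q + 1) := by rw [hpq]; ring
  rw [e1, e2, hDq]
  rcases Nat.even_or_odd n with hn | hn
  · rw [hn.neg_one_pow, hn.neg_one_pow, card_idxParity_one hp hq]
    push_cast
    field_simp
    ring
  · rw [hn.neg_one_pow, hn.neg_one_pow, card_idxParity_neg_one hp hq]
    push_cast
    field_simp
    ring

lemma exists_bounds (hp : 2 < p) {D N : ℕ}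
    (hD : 2 * D = Fintype.card (SpecialLinearGroup (Fin 2) (ZMod p)))
    (hN : N + 2 = Fintype.card (SpecialLinearGroup (Fin 2) (ZMod p))) {n : ℕ} {k : ℕ}
    {W : Fin k → FDRep (ZMod p) (SpecialLinearGroup (Fin 2) (ZMod p))}
    (hW : ∀ t, Indecomposable (W t)) (i : tpow (FDRep.of (natRep p)) n ≅ ⨁ W) :
    ∃ x : ℕ, x * D + (2 ^ N - D) ^ (n / N) * 2 ^ (n % N) = 2 ^ n ∧
      x * (idxParity p ((-1 : ZMod p) ^ n)).card ≤ k ∧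
      k + x * D ≤ x * (idxParity p ((-1 : ZMod p) ^ n)).card + 2 ^ n := by
  have hdim : Module.finrank (ZMod p) (FDRep.of (natRep p)) = 2 := Module.finrank_fin_fun _
  obtain ⟨x, hx, h⟩ := exists_hasSystem_tpow (z := -1) (FDRep.of (natRep p))
    (two_ne_zero_zmod hp) (neg_one_ne_one hp) (by simp) natRep_neg_one
    (fun g h1 h2 => exists_coeff_natRep g h1 h2) hdim hD hN (n / N) (n % N)
  have hn : n / N * N + n % N = n := Nat.div_add_mod' n N
  have hε : (-1 : ZMod p) ^ (n % N) = (-1) ^ n := by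
    have hNe : Even N := ⟨D - 1, by omega⟩
    conv_rhs => rw [← hn, pow_add, (hNe.mul_left _).neg_one_pow, one_mul]
  rw [hn, hε] at h
  have hb := card_summands_bounds hp _ (neg_one_pow_eq_or _ _) h hW i hD
  rw [finrank_tpow, hdim] at hb
  refine ⟨x * 2 ^ (n % N), ?_, hb⟩
  rw [mul_right_comm, ← add_mul, hx, ← pow_add, hn]

end SLTwo

/-- For `G = SL₂(F_p)`, `p > 2` prime, and `V = F_p²` its natural representation, the
number `b n` of indecomposable summands (with multiplicity) of `V^{⊗n}` satisfies
`b n / a n → 1` where `a n = (1/(2p-2) + (-1)^n/(2p²-2p))·2^n`. -/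
theorem sl2_tensor_power_asymptotics
    (p : ℕ) [Fact p.Prime] (hp : 2 < p)
    (V : FDRep (ZMod p) (Matrix.SpecialLinearGroup (Fin 2) (ZMod p)))
    (hV : V = FDRep.of (natRep p))
    (b : ℕ → ℕ)
    (hb : ∀ n : ℕ, ∃ (k : ℕ)
      (W : Fin k → FDRep (ZMod p) (Matrix.SpecialLinearGroup (Fin 2) (ZMod p))),
      (∀ t, Indecomposable (W t)) ∧ Nonempty (tpow V n ≅ ⨁ W) ∧ b n = k)
    (a : ℕ → ℝ)
    (ha : ∀ n : ℕ, a n =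
      (1 / (2 * p - 2) + (-1 : ℝ) ^ n / (2 * p ^ 2 - 2 * p)) * 2 ^ n) :
    Filter.Tendsto (fun n => (b n : ℝ) / a n) Filter.atTop (nhds 1) := by
  subst hV
  have hcard := SLTwo.card_specialLinearGroup (p := p)
  obtain ⟨q, hq⟩ : ∃ q, p = 2 * q + 1 := (Fact.out : p.Prime).odd_of_ne_two (by omega)
  obtain ⟨D, hD⟩ : ∃ D, 2 * D = Fintype.card (Matrix.SpecialLinearGroup (Fin 2) (ZMod p)) := by
    refine ⟨p * (2 * q * (q + 1)), ?_⟩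
    have h1 : p ^ 2 - 1 = 2 * (2 * q * (q + 1)) := by
      rw [hq, Nat.sub_eq_iff_eq_add (Nat.one_le_pow _ _ (by omega))]
      ring
    rw [hcard, h1]
    ring
  have hp2 : 8 ≤ p ^ 2 - 1 := by
    have : 3 ^ 2 ≤ p ^ 2 := Nat.pow_le_pow_left hp 2
    omega
  have hbig : 24 ≤ Fintype.card (Matrix.SpecialLinearGroup (Fin 2) (ZMod p)) := by
    rw [hcard]
    exact Nat.mul_le_mul hp hp2
  obtain ⟨N, hN⟩ : ∃ N, N + 2 = Fintype.card (Matrix.SpecialLinearGroup (Fin 2) (ZMod p)) :=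
    ⟨Fintype.card (Matrix.SpecialLinearGroup (Fin 2) (ZMod p)) - 2, by omega⟩
  have hN0 : 0 < N := by omega
  have hD0 : (0 : ℝ) < D := by
    have : 0 < D := by omega
    exact_mod_cast this
  set r : ℝ := ((2 ^ N - D : ℕ) : ℝ) / 2 ^ N with hr
  have hr0 : 0 ≤ r := by positivity
  have hr1 : r < 1 := by
    rw [hr, div_lt_one (by positivity)]
    have : 2 ^ N - D < 2 ^ N := Nat.sub_lt (by positivity) (by omega)
    exact_mod_cast this
  have hlim : Filter.Tendsto (fun n => r ^ (n / N)) Filter.atTop (nhds 0) :=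
    (tendsto_pow_atTop_nhds_zero_of_lt_one hr0 hr1).comp
      (Nat.tendsto_div_const_atTop hN0.ne')
  have key : ∀ n, 1 - r ^ (n / N) ≤ b n / a n ∧ b n / a n ≤ 1 + D * r ^ (n / N) := by
    intro n
    obtain ⟨k, W, hW, ⟨i⟩, hk⟩ := hb n
    obtain ⟨x, hx, h1, h2⟩ := SLTwo.exists_bounds hp hD hN hW i
    rw [← hk] at h1 h2
    have hℓ : 1 ≤ (SLTwo.idxParity p ((-1 : ZMod p) ^ n)).card := by
      rcases neg_one_pow_eq_or (ZMod p) n with h | h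
      · rw [h, SLTwo.card_idxParity_one hp hq]
        exact Nat.one_le_pow _ _ (by omega)
      · rw [h, SLTwo.card_idxParity_neg_one hp hq]
        exact Nat.mul_pos (by omega) (by omega)
    have hc := SLTwo.mul_eq_card_idxParity hp hD n
    generalize (SLTwo.idxParity p ((-1 : ZMod p) ^ n)).card = ℓ at *
    have haD : a n * D = ℓ * 2 ^ n := by rw [ha, mul_right_comm, hc]
    have hx' : (x : ℝ) * D + r ^ (n / N) * 2 ^ n = 2 ^ n := by
      have : r ^ (n / N) * 2 ^ n = ((2 ^ N - D : ℕ) : ℝ) ^ (n / N) * 2 ^ (n % N) := by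
        have h2n : (2 : ℝ) ^ n = (2 ^ N) ^ (n / N) * 2 ^ (n % N) := by
          rw [← pow_mul, ← pow_add, Nat.div_add_mod]
        rw [h2n, hr, div_pow, ← mul_assoc, div_mul_cancel₀ _ (by positivity)]
      rw [this]
      exact_mod_cast hx
    have h1' : (x : ℝ) * ℓ ≤ b n := by exact_mod_cast h1
    have h2' : (b n : ℝ) + x * D ≤ x * ℓ + 2 ^ n := by exact_mod_cast h2
    have hℓ' : (1 : ℝ) ≤ ℓ := by exact_mod_cast hℓ
    have h2n : (0 : ℝ) < 2 ^ n := by positivity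
    have hR : 0 ≤ r ^ (n / N) := by positivity
    have ha0 : 0 < a n := by
      have : 0 < a n * D := by rw [haD]; positivity
      exact (mul_pos_iff_of_pos_right hD0).1 this
    generalize r ^ (n / N) = R at *
    have hxℓ : x * ℓ = a n * (1 - R) := by
      apply mul_right_cancel₀ hD0.ne'
      have : (x : ℝ) * D = (1 - R) * 2 ^ n := by linarith
      calc (x : ℝ) * ℓ * D = ℓ * (x * D) := by ring
        _ = ℓ * 2 ^ n * (1 - R) := by rw [this]; ring
        _ = a n * (1 - R) * D := by rw [← haD]; ring
    constructor
    · rw [le_div_iff₀ ha0]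
      linarith
    · rw [div_le_iff₀ ha0]
      have h3 : 2 ^ n * R ≤ a n * D * R := by
        rw [haD]
        apply mul_le_mul_of_nonneg_right _ hR
        nlinarith
      have h4 : 0 ≤ a n * R := by positivity
      nlinarith
  refine tendsto_of_tendsto_of_tendsto_of_le_of_le ?_ ?_ (fun n => (key n).1) fun n => (key n).2
  · simpa using hlim.const_sub 1
  · simpa using (hlim.const_mul (D : ℝ)).const_add 1
end
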